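/- arXiv:2501.17254 — 4 statements merged into one kernel-verified Lean document; each statement's English description precedes it below -/
import Mathlib

section
/- Let F be a finite-dimensional real inner product space, Ω ⊆ ℝ^N open, Γ ∈ C¹(Ω, L(ℝ^N, o(F))) a connection form, J ⊆ ℝ open, and H ∈ C¹([0,1]×J, Ω); write γ_s = H(·,s). Let P : [0,1]×J → L(F,F) be C¹ and suppose that for each s ∈ J the map t ↦ P(t,s) satisfies ∂_t P(t,s) = −Γ(γ_s(t))[∂_t γ_s(t)] ∘ P(t,s) and P(1,s) = id_F. Then each P(t,s) is invertible and, for all s ∈ J, ∂_s P(0,s) + Γ(γ_s(0))[∂_s γ_s(0)] ∘ P(0,s) − P(0,s) ∘ Γ(γ_s(1))[∂_s γ_s(1)] = ∫₀¹ P(0,s) ∘ P(t,s)⁻¹ ∘ K_Γ(γ_s(t))[∂_s γ_s(t), ∂_t γ_s(t)] ∘ P(t,s) dt. -/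
set_option synthInstance.maxHeartbeats 1000000
set_option maxHeartbeats 1000000

open Set intervalIntegral
open scoped RealInnerProductSpace

theorem ptaux_bilin {E₁ E₂ E₃ : Type*} [NormedAddCommGroup E₁] [NormedSpace ℝ E₁]
    [NormedAddCommGroup E₂] [NormedSpace ℝ E₂] [NormedAddCommGroup E₃] [NormedSpace ℝ E₃]
    (B : E₁ →L[ℝ] E₂ →L[ℝ] E₃) {f : ℝ → E₁} {f' : E₁} {c : ℝ → E₂} {s : ℝ}
    (h0 : f s = 0) (hf : HasDerivAt f f' s) (hc : ContinuousAt c s) :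
    HasDerivAt (fun x => B (f x) (c x)) (B f' (c s)) s := by
  rw [hasDerivAt_iff_tendsto_slope] at hf ⊢
  have h1 : Filter.Tendsto (fun x => B (slope f s x) (c x)) (nhdsWithin s {s}ᶜ)
      (nhds (B f' (c s))) := by
    exact (B.continuous₂.tendsto (f', c s)).comp
      (hf.prodMk_nhds (hc.tendsto.mono_left nhdsWithin_le_nhds))
  refine h1.congr fun x => ?_
  simp [slope_def_module, h0]

theorem ptaux_param {X : Type*} [NormedAddCommGroup X] [NormedSpace ℝ X]
    (g : ℝ → ℝ → X) (g' : ℝ → X) (s : ℝ) (B : Set ℝ) (hB : B ∈ nhds s)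
    (hg : ∀ x ∈ B, ContinuousOn (g x) (Icc (0:ℝ) 1))
    (C : ℝ) (hC : ∀ x ∈ B, ∀ t ∈ Icc (0:ℝ) 1, ‖g x t - g s t‖ ≤ C * ‖x - s‖)
    (hd : ∀ t ∈ Icc (0:ℝ) 1, HasDerivAt (fun x => g x t) (g' t) s) :
    HasDerivAt (fun x => ∫ t in (0:ℝ)..1, g x t) (∫ t in (0:ℝ)..1, g' t) s := by
  have hsub : uIoc (0:ℝ) 1 ⊆ Icc (0:ℝ) 1 := by
    rw [uIoc_of_le zero_le_one]; exact Ioc_subset_Icc_self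
  have hint : ∀ x ∈ B, IntervalIntegrable (g x) MeasureTheory.volume 0 1 := fun x hx => by
    apply ContinuousOn.intervalIntegrable
    rw [uIcc_of_le zero_le_one]; exact hg x hx
  rw [hasDerivAt_iff_tendsto_slope]
  have hB' : ∀ᶠ x in nhdsWithin s {s}ᶜ, x ∈ B := mem_nhdsWithin_of_mem_nhds hB
  have key : Filter.Tendsto (fun x => ∫ t in (0:ℝ)..1, slope (fun y => g y t) s x)
      (nhdsWithin s {s}ᶜ) (nhds (∫ t in (0:ℝ)..1, g' t)) := by
    apply intervalIntegral.tendsto_integral_filter_of_dominated_convergence (fun _ => C)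
    · filter_upwards [hB'] with x hx
      have : IntervalIntegrable (fun t => slope (fun y => g y t) s x) MeasureTheory.volume 0 1 := by
        simp only [slope_def_module]
        exact ((hint x hx).sub (hint s (mem_of_mem_nhds hB))).smul _
      have h2 := this.aestronglyMeasurable
      rwa [uIoc_of_le zero_le_one]
    · filter_upwards [hB', self_mem_nhdsWithin] with x hx hne
      refine Filter.Eventually.of_forall fun t ht => ?_
      have hpos : 0 < ‖x - s‖ := norm_pos_iff.2 (sub_ne_zero.2 hne)
      rw [slope_def_module, norm_smul, norm_inv, inv_mul_le_iff₀ hpos, mul_comm]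
      exact hC x hx t (hsub ht)
    · exact intervalIntegrable_const
    · refine Filter.Eventually.of_forall fun t ht => ?_
      exact hasDerivAt_iff_tendsto_slope.1 (hd t (hsub ht))
  refine key.congr' ?_
  filter_upwards [hB'] with x hx
  simp only [slope_def_module]
  rw [intervalIntegral.integral_smul,
    intervalIntegral.integral_sub (hint x hx) (hint s (mem_of_mem_nhds hB))]

theorem ptaux_core {𝔸 E : Type*} [NormedRing 𝔸] [NormedAlgebra ℝ 𝔸] [CompleteSpace 𝔸]
    [NormedAddCommGroup E] [NormedSpace ℝ E]
    (Ω : Set E) (Γ : E → E →L[ℝ] 𝔸) (DΓ : E → E →L[ℝ] E →L[ℝ] 𝔸)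
    (hΓ : ∀ x ∈ Ω, HasFDerivAt Γ (DΓ x) x) (hDΓcont : ContinuousOn DΓ Ω)
    (J : Set ℝ) (hJ : IsOpen J) (H Ht Hs : ℝ → ℝ → E)
    (hHΩ : ∀ s ∈ J, ∀ t ∈ Icc (0:ℝ) 1, H t s ∈ Ω)
    (hHt : ∀ s ∈ J, ∀ t ∈ Icc (0:ℝ) 1,
      HasDerivWithinAt (fun t' => H t' s) (Ht t s) (Icc (0:ℝ) 1) t)
    (hHs : ∀ s ∈ J, ∀ t ∈ Icc (0:ℝ) 1, HasDerivAt (fun s' => H t s') (Hs t s) s)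
    (hHtcont : ContinuousOn (fun q : ℝ × ℝ => Ht q.1 q.2) (Icc (0:ℝ) 1 ×ˢ J))
    (hHscont : ContinuousOn (fun q : ℝ × ℝ => Hs q.1 q.2) (Icc (0:ℝ) 1 ×ˢ J))
    (P Ps : ℝ → ℝ → 𝔸)
    (hPt : ∀ s ∈ J, ∀ t ∈ Icc (0:ℝ) 1,
      HasDerivWithinAt (fun t' => P t' s)
        (-(Γ (H t s) (Ht t s) * P t s)) (Icc (0:ℝ) 1) t)
    (hPs : ∀ s ∈ J, ∀ t ∈ Icc (0:ℝ) 1, HasDerivAt (fun s' => P t s') (Ps t s) s)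
    (hPcont : ContinuousOn (fun q : ℝ × ℝ => P q.1 q.2) (Icc (0:ℝ) 1 ×ˢ J))
    (s : ℝ) (hs : s ∈ J) (Q : ℝ → 𝔸)
    (hQ : ∀ t ∈ Icc (0:ℝ) 1,
      HasDerivWithinAt Q (Q t * Γ (H t s) (Ht t s)) (Icc (0:ℝ) 1) t) :
    (∫ t in (0:ℝ)..1, Q t * (Γ (H t s) (Ht t s) * Γ (H t s) (Hs t s)
        - Γ (H t s) (Hs t s) * Γ (H t s) (Ht t s)
        + DΓ (H t s) (Ht t s) (Hs t s) - DΓ (H t s) (Hs t s) (Ht t s)) * P t s)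
      = Q 1 * (Γ (H 1 s) (Hs 1 s) * P 1 s + Ps 1 s)
        - Q 0 * (Γ (H 0 s) (Hs 0 s) * P 0 s + Ps 0 s) := by
  obtain ⟨ε, hε, hBJ⟩ : ∃ ε > 0, Metric.closedBall s ε ⊆ J :=
    Metric.nhds_basis_closedBall.mem_iff.1 (hJ.mem_nhds hs)
  set B := Metric.closedBall s ε with hBdef
  have hB : B ∈ nhds s := Metric.closedBall_mem_nhds s hε
  have hsB : s ∈ B := mem_of_mem_nhds hB
  have hBconv : Convex ℝ B := convex_closedBall s ε
  have hK : IsCompact (Icc (0:ℝ) 1 ×ˢ B) := isCompact_Icc.prod (isCompact_closedBall s ε)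
  have hKsub : Icc (0:ℝ) 1 ×ˢ B ⊆ Icc (0:ℝ) 1 ×ˢ J := prod_mono_right hBJ
  obtain ⟨M₁, hM₁⟩ := hK.exists_bound_of_continuousOn (hHscont.mono hKsub)
  obtain ⟨M₂, hM₂⟩ := hK.exists_bound_of_continuousOn (hHtcont.mono hKsub)
  obtain ⟨M₃, hM₃⟩ := hK.exists_bound_of_continuousOn (hPcont.mono hKsub)
  have hM₁0 : 0 ≤ M₁ := (norm_nonneg _).trans (hM₁ (0, s) ⟨by simp, hsB⟩)
  have hM₂0 : 0 ≤ M₂ := (norm_nonneg _).trans (hM₂ (0, s) ⟨by simp, hsB⟩)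
  have hM₃0 : 0 ≤ M₃ := (norm_nonneg _).trans (hM₃ (0, s) ⟨by simp, hsB⟩)
  have hΔ : ∀ t ∈ Icc (0:ℝ) 1, ∀ x ∈ B, ∀ y ∈ B, ‖H t y - H t x‖ ≤ M₁ * ‖y - x‖ := by
    intro t ht x hx y hy
    exact hBconv.norm_image_sub_le_of_norm_hasDerivWithin_le
      (fun z hz => (hHs z (hBJ hz) t ht).hasDerivWithinAt) (fun z hz => hM₁ (t, z) ⟨ht, hz⟩) hx hy
  have hHcont : ContinuousOn (fun q : ℝ × ℝ => H q.1 q.2) (Icc (0:ℝ) 1 ×ˢ B) := by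
    apply continuousOn_prod_of_continuousOn_lipschitzOnWith' _ ⟨M₁, hM₁0⟩
    · intro t ht
      refine LipschitzOnWith.of_dist_le_mul fun x hx y hy => ?_
      rw [dist_eq_norm, dist_eq_norm]
      exact hΔ t ht y hy x hx
    · intro x hx t ht
      exact (hHt x (hBJ hx) t ht).continuousWithinAt
  have hmaps : MapsTo (fun q : ℝ × ℝ => H q.1 q.2) (Icc (0:ℝ) 1 ×ˢ B) Ω :=
    fun q hq => hHΩ q.2 (hBJ hq.2) q.1 hq.1
  have hΓcont : ContinuousOn Γ Ω := fun x hx => (hΓ x hx).continuousAt.continuousWithinAt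
  obtain ⟨M₄, hM₄⟩ := hK.exists_bound_of_continuousOn (hΓcont.comp hHcont hmaps)
  have hDc : ContinuousOn (fun q : ℝ × ℝ => DΓ (H q.1 q.2)) (Icc (0:ℝ) 1 ×ˢ B) :=
    hDΓcont.comp hHcont hmaps
  obtain ⟨M₅, hM₅⟩ := hK.exists_bound_of_continuousOn (E := E →L[ℝ] E →L[ℝ] 𝔸)
    (f := fun q : ℝ × ℝ => DΓ (H q.1 q.2)) hDc
  have hM₄0 : 0 ≤ M₄ := (norm_nonneg _).trans (hM₄ (0, s) ⟨by simp, hsB⟩)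
  have hM₅0 : 0 ≤ M₅ := (norm_nonneg _).trans (hM₅ (0, s) ⟨by simp, hsB⟩)
  have hQcont : ContinuousOn Q (Icc (0:ℝ) 1) := fun t ht => (hQ t ht).continuousWithinAt
  obtain ⟨M₆, hM₆⟩ := isCompact_Icc.exists_bound_of_continuousOn hQcont
  have hM₆0 : 0 ≤ M₆ := (norm_nonneg _).trans (hM₆ 0 (by simp))
  have hΓs : ∀ t ∈ Icc (0:ℝ) 1, ∀ x ∈ B,
      HasDerivAt (fun y => Γ (H t y)) (DΓ (H t x) (Hs t x)) x := fun t ht x hx =>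
    (hΓ _ (hHΩ x (hBJ hx) t ht)).comp_hasDerivAt x (hHs x (hBJ hx) t ht)
  have hΓΔ : ∀ t ∈ Icc (0:ℝ) 1, ∀ x ∈ B, ‖Γ (H t x) - Γ (H t s)‖ ≤ M₅ * M₁ * ‖x - s‖ := by
    intro t ht x hx
    refine hBconv.norm_image_sub_le_of_norm_hasDerivWithin_le
      (fun z hz => (hΓs t ht z hz).hasDerivWithinAt) (fun z hz => ?_) hsB hx
    refine (ContinuousLinearMap.le_opNorm _ _).trans ?_
    gcongr
    · exact hM₅ (t, z) ⟨ht, hz⟩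
    · exact hM₁ (t, z) ⟨ht, hz⟩
  -- slices
  have hslice : ∀ x ∈ B, MapsTo (fun t : ℝ => (t, x)) (Icc (0:ℝ) 1) (Icc (0:ℝ) 1 ×ˢ B) :=
    fun x hx t ht => ⟨ht, hx⟩
  have hsl : ∀ x : ℝ, ContinuousOn (fun t : ℝ => (t, x)) (Icc (0:ℝ) 1) := fun x => by fun_prop
  have cH : ∀ x ∈ B, ContinuousOn (fun t => H t x) (Icc (0:ℝ) 1) := fun x hx =>
    hHcont.comp (hsl x) (hslice x hx)
  have cHt : ∀ x ∈ B, ContinuousOn (fun t => Ht t x) (Icc (0:ℝ) 1) := fun x hx =>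
    (hHtcont.mono hKsub).comp (hsl x) (hslice x hx)
  have cP : ∀ x ∈ B, ContinuousOn (fun t => P t x) (Icc (0:ℝ) 1) := fun x hx =>
    (hPcont.mono hKsub).comp (hsl x) (hslice x hx)
  have cΓ : ∀ x ∈ B, ContinuousOn (fun t => Γ (H t x)) (Icc (0:ℝ) 1) := fun x hx =>
    (hΓcont.comp hHcont hmaps).comp (hsl x) (hslice x hx)
  have cDΓ : ∀ x ∈ B, ContinuousOn (fun t => DΓ (H t x)) (Icc (0:ℝ) 1) := fun x hx =>
    (hDΓcont.comp hHcont hmaps).comp (hsl x) (hslice x hx)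
  -- continuity in the parameter
  have hslice' : ∀ t ∈ Icc (0:ℝ) 1, MapsTo (fun x : ℝ => (t, x)) B (Icc (0:ℝ) 1 ×ˢ B) :=
    fun t ht x hx => ⟨ht, hx⟩
  have hsl' : ∀ t : ℝ, ContinuousOn (fun x : ℝ => (t, x)) B := fun t => by fun_prop
  have pHt : ∀ t ∈ Icc (0:ℝ) 1, ContinuousAt (fun x => Ht t x) s := fun t ht =>
    ((hHtcont.mono hKsub).comp (hsl' t) (hslice' t ht)).continuousAt hB
  have pP : ∀ t ∈ Icc (0:ℝ) 1, ContinuousAt (fun x => P t x) s := fun t ht =>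
    (hPs s hs t ht).continuousAt
  have pΓ : ∀ t ∈ Icc (0:ℝ) 1, ContinuousAt (fun x => Γ (H t x)) s := fun t ht =>
    (hΓs t ht s hsB).continuousAt
  let X : ℝ → ℝ → 𝔸 := fun x t =>
    Γ (H t s) (Ht t s) * Γ (H t s) (H t x - H t s)
      - Γ (H t s) (H t x - H t s) * Γ (H t x) (Ht t x)
      + DΓ (H t s) (Ht t s) (H t x - H t s) - (Γ (H t x) - Γ (H t s)) (Ht t x)
  let g : ℝ → ℝ → 𝔸 := fun x t => Q t * X x t * P t x
  let G : ℝ → ℝ → 𝔸 := fun x t => Q t * (1 + Γ (H t s) (H t x - H t s)) * P t x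
  have hgcont : ∀ x ∈ B, ContinuousOn (g x) (Icc (0:ℝ) 1) := by
    intro x hx
    have a1 : ContinuousOn (fun t => H t x - H t s) (Icc (0:ℝ) 1) := (cH x hx).sub (cH s hsB)
    have a2 := (cΓ s hsB).clm_apply a1
    exact (hQcont.mul ((((((cΓ s hsB).clm_apply (cHt s hsB)).mul a2).sub
      (a2.mul ((cΓ x hx).clm_apply (cHt x hx)))).add
      (((cDΓ s hsB).clm_apply (cHt s hsB)).clm_apply a1)).sub
      (((cΓ x hx).sub (cΓ s hsB)).clm_apply (cHt x hx)))).mul (cP x hx)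
  have hGderiv : ∀ x ∈ B, ∀ t ∈ Icc (0:ℝ) 1,
      HasDerivWithinAt (G x) (g x t) (Icc (0:ℝ) 1) t := by
    intro x hx t ht
    have b1 : HasDerivWithinAt (fun t => Γ (H t s)) (DΓ (H t s) (Ht t s)) (Icc (0:ℝ) 1) t :=
      (hΓ _ (hHΩ s hs t ht)).comp_hasDerivWithinAt t (hHt s hs t ht)
    have b2 := b1.clm_apply ((hHt x (hBJ hx) t ht).sub (hHt s hs t ht))
    have b3 := ((hQ t ht).mul (b2.const_add 1)).mul (hPt x (hBJ hx) t ht)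
    refine b3.congr_deriv ?_
    simp only [g, X, map_sub, sub_apply, Pi.sub_apply, Pi.mul_apply]
    noncomm_ring
  have hFTC : ∀ x ∈ B, ∫ t in (0:ℝ)..1, g x t = G x 1 - G x 0 := by
    intro x hx
    refine integral_eq_sub_of_hasDerivAt_of_le zero_le_one
      (fun t ht => (hGderiv x hx t ht).continuousWithinAt)
      (fun t ht => (hGderiv x hx t (Ioo_subset_Icc_self ht)).hasDerivAt (Icc_mem_nhds ht.1 ht.2)) ?_
    apply ContinuousOn.intervalIntegrable
    rw [uIcc_of_le zero_le_one]; exact hgcont x hx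
  have hXs : ∀ t, X s t = 0 := fun t => by simp [X]
  have dΔ : ∀ t ∈ Icc (0:ℝ) 1, HasDerivAt (fun x => H t x - H t s) (Hs t s) s := fun t ht =>
    (hHs s hs t ht).sub_const _
  have dΓΔ : ∀ t ∈ Icc (0:ℝ) 1,
      HasDerivAt (fun x => Γ (H t s) (H t x - H t s)) (Γ (H t s) (Hs t s)) s := fun t ht =>
    (Γ (H t s)).hasFDerivAt.comp_hasDerivAt s (dΔ t ht)
  have hgderiv : ∀ t ∈ Icc (0:ℝ) 1, HasDerivAt (fun x => g x t)
      (Q t * (Γ (H t s) (Ht t s) * Γ (H t s) (Hs t s)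
        - Γ (H t s) (Hs t s) * Γ (H t s) (Ht t s)
        + DΓ (H t s) (Ht t s) (Hs t s) - DΓ (H t s) (Hs t s) (Ht t s)) * P t s) s := by
    intro t ht
    have e1 := (dΓΔ t ht).const_mul (Γ (H t s) (Ht t s))
    have e2 := ptaux_bilin (ContinuousLinearMap.mul ℝ 𝔸) (by simp) (dΓΔ t ht)
      ((pΓ t ht).clm_apply (pHt t ht))
    have e3 : HasDerivAt (fun x => DΓ (H t s) (Ht t s) (H t x - H t s))
        (DΓ (H t s) (Ht t s) (Hs t s)) s :=
      (DΓ (H t s) (Ht t s)).hasFDerivAt.comp_hasDerivAt s (dΔ t ht)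
    have e4 := ptaux_bilin (ContinuousLinearMap.id ℝ (E →L[ℝ] 𝔸))
      (f := fun x => Γ (H t x) - Γ (H t s)) (by simp)
      ((hΓs t ht s hsB).sub_const (Γ (H t s))) (pHt t ht)
    have e5 : HasDerivAt (fun x => X x t) _ s := ((e1.sub e2).add e3).sub e4
    have e6 := ptaux_bilin (ContinuousLinearMap.mul ℝ 𝔸) (by simp [hXs]) (e5.const_mul (Q t))
      (pP t ht)
    exact e6
  have hbound : ∀ x ∈ B, ∀ t ∈ Icc (0:ℝ) 1, ‖g x t - g s t‖ ≤
      (M₆ * ((M₄ * M₂) * (M₄ * M₁) + (M₄ * M₁) * (M₄ * M₂) + M₅ * M₂ * M₁ + M₅ * M₁ * M₂) * M₃)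
        * ‖x - s‖ := by
    intro x hx t ht
    have z : g s t = 0 := by simp [g, hXs]
    rw [z, sub_zero]
    have n0 := hΔ t ht s hsB x hx
    have n1 : ∀ y ∈ B, ‖Γ (H t y) (Ht t y)‖ ≤ M₄ * M₂ := fun y hy =>
      ContinuousLinearMap.le_of_opNorm_le_of_le _ (hM₄ (t, y) ⟨ht, hy⟩) (hM₂ (t, y) ⟨ht, hy⟩)
    have n2 : ‖Γ (H t s) (H t x - H t s)‖ ≤ M₄ * (M₁ * ‖x - s‖) :=
      ContinuousLinearMap.le_of_opNorm_le_of_le _ (hM₄ (t, s) ⟨ht, hsB⟩) n0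
    have n3 : ‖DΓ (H t s) (Ht t s) (H t x - H t s)‖ ≤ M₅ * M₂ * (M₁ * ‖x - s‖) :=
      ContinuousLinearMap.le_of_opNorm_le_of_le _
        (ContinuousLinearMap.le_of_opNorm_le_of_le _ (hM₅ (t, s) ⟨ht, hsB⟩)
          (hM₂ (t, s) ⟨ht, hsB⟩)) n0
    have n4 : ‖(Γ (H t x) - Γ (H t s)) (Ht t x)‖ ≤ M₅ * M₁ * ‖x - s‖ * M₂ :=
      ContinuousLinearMap.le_of_opNorm_le_of_le _ (hΓΔ t ht x hx) (hM₂ (t, x) ⟨ht, hx⟩)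
    have n5 : ‖X x t‖ ≤ (M₄ * M₂) * (M₄ * (M₁ * ‖x - s‖)) + (M₄ * (M₁ * ‖x - s‖)) * (M₄ * M₂)
        + M₅ * M₂ * (M₁ * ‖x - s‖) + M₅ * M₁ * ‖x - s‖ * M₂ := by
      refine (norm_sub_le _ _).trans (add_le_add ((norm_add_le _ _).trans (add_le_add
        ((norm_sub_le _ _).trans (add_le_add ?_ ?_)) n3)) n4)
      · exact norm_mul_le_of_le (n1 s hsB) n2
      · exact norm_mul_le_of_le n2 (n1 x hx)
    have n6 : ‖g x t‖ ≤ _ :=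
      norm_mul_le_of_le (norm_mul_le_of_le (hM₆ t ht) n5) (hM₃ (t, x) ⟨ht, hx⟩)
    refine n6.trans (le_of_eq ?_)
    ring
  have hL := ptaux_param g _ s B hB hgcont _ hbound hgderiv
  have hGd : ∀ t ∈ Icc (0:ℝ) 1, HasDerivAt (fun x => G x t)
      (Q t * (Γ (H t s) (Hs t s) * P t s + Ps t s)) s := by
    intro t ht
    have h1 := (((dΓΔ t ht).const_add 1).const_mul (Q t)).mul (hPs s hs t ht)
    refine h1.congr_deriv ?_
    simp [mul_add, mul_assoc]
  have hR := (hGd 1 (by simp)).sub (hGd 0 (by simp))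
  refine hL.unique (hR.congr_of_eventuallyEq ?_)
  filter_upwards [hB] with x hx
  exact hFTC x hx

/-- Derivative of parallel transport with respect to a parameter:
`∂ₛ P(0,s) + Γ(γₛ(0))[∂ₛγₛ(0)] ∘ P(0,s) − P(0,s) ∘ Γ(γₛ(1))[∂ₛγₛ(1)]
  = ∫₀¹ P(0,s) ∘ P(t,s)⁻¹ ∘ K_Γ(γₛ(t))[∂ₛγₛ(t), ∂ₜγₛ(t)] ∘ P(t,s) dt`,
each `P(t,s)` being invertible. -/
theorem parallel_transport_parameter_derivative
    {F : Type*} [NormedAddCommGroup F] [InnerProductSpace ℝ F] [FiniteDimensional ℝ F]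
    {N : ℕ}
    (Ω : Set (EuclideanSpace ℝ (Fin N))) (hΩ : IsOpen Ω)
    -- Γ of class C¹ on Ω with derivative DΓ, with skew-adjoint values
    (Γ : EuclideanSpace ℝ (Fin N) → EuclideanSpace ℝ (Fin N) →L[ℝ] F →L[ℝ] F)
    (DΓ : EuclideanSpace ℝ (Fin N) →
      EuclideanSpace ℝ (Fin N) →L[ℝ] EuclideanSpace ℝ (Fin N) →L[ℝ] F →L[ℝ] F)
    (hΓ : ∀ x ∈ Ω, HasFDerivAt Γ (DΓ x) x)
    (hDΓcont : ContinuousOn DΓ Ω)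
    (hskew : ∀ x ∈ Ω, ∀ (v : EuclideanSpace ℝ (Fin N)) (u w : F),
      ⟪(Γ x v) u, w⟫ = -⟪u, (Γ x v) w⟫)
    -- the C¹ family of paths H(t, s) = γₛ(t), with partial derivatives Ht, Hs
    (J : Set ℝ) (hJ : IsOpen J)
    (H Ht Hs : ℝ → ℝ → EuclideanSpace ℝ (Fin N))
    (hHΩ : ∀ s ∈ J, ∀ t ∈ Icc (0:ℝ) 1, H t s ∈ Ω)
    (hHt : ∀ s ∈ J, ∀ t ∈ Icc (0:ℝ) 1,
      HasDerivWithinAt (fun t' => H t' s) (Ht t s) (Icc (0:ℝ) 1) t)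
    (hHs : ∀ s ∈ J, ∀ t ∈ Icc (0:ℝ) 1, HasDerivAt (fun s' => H t s') (Hs t s) s)
    (hHtcont : ContinuousOn (fun q : ℝ × ℝ => Ht q.1 q.2) (Icc (0:ℝ) 1 ×ˢ J))
    (hHscont : ContinuousOn (fun q : ℝ × ℝ => Hs q.1 q.2) (Icc (0:ℝ) 1 ×ˢ J))
    -- the C¹ family of parallel transports P(t,s) with partial derivative ∂ₛP = Ps
    (P Ps : ℝ → ℝ → F →L[ℝ] F)
    (hPt : ∀ s ∈ J, ∀ t ∈ Icc (0:ℝ) 1,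
      HasDerivWithinAt (fun t' => P t' s)
        (-((Γ (H t s)) (Ht t s)).comp (P t s)) (Icc (0:ℝ) 1) t)
    (hP1 : ∀ s ∈ J, P 1 s = ContinuousLinearMap.id ℝ F)
    (hPs : ∀ s ∈ J, ∀ t ∈ Icc (0:ℝ) 1, HasDerivAt (fun s' => P t s') (Ps t s) s)
    (hPcont : ContinuousOn (fun q : ℝ × ℝ => P q.1 q.2) (Icc (0:ℝ) 1 ×ˢ J))
    (hPscont : ContinuousOn (fun q : ℝ × ℝ => Ps q.1 q.2) (Icc (0:ℝ) 1 ×ˢ J)) :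
    ∃ Q : ℝ → ℝ → F →L[ℝ] F,
      (∀ s ∈ J, ∀ t ∈ Icc (0:ℝ) 1,
        (Q t s).comp (P t s) = ContinuousLinearMap.id ℝ F ∧
        (P t s).comp (Q t s) = ContinuousLinearMap.id ℝ F) ∧
      ∀ s ∈ J,
        Ps 0 s + ((Γ (H 0 s)) (Hs 0 s)).comp (P 0 s)
            - (P 0 s).comp ((Γ (H 1 s)) (Hs 1 s))
          = ∫ t in (0:ℝ)..1,
              (P 0 s).comp ((Q t s).comp
                ((((DΓ (H t s)) (Hs t s)) (Ht t s) - ((DΓ (H t s)) (Ht t s)) (Hs t s)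
                  + ((Γ (H t s)) (Hs t s)).comp ((Γ (H t s)) (Ht t s))
                  - ((Γ (H t s)) (Ht t s)).comp ((Γ (H t s)) (Hs t s))).comp (P t s))) := by
  have : CompleteSpace F := FiniteDimensional.complete ℝ F
  have hstar : ∀ x ∈ Ω, ∀ v, star (Γ x v) = -(Γ x v) := by
    intro x hx v
    rw [ContinuousLinearMap.star_eq_adjoint]
    symm
    rw [ContinuousLinearMap.eq_adjoint_iff]
    intro u w
    rw [neg_apply, inner_neg_left, hskew x hx, neg_neg]
  have hQd : ∀ s ∈ J, ∀ t ∈ Icc (0:ℝ) 1, HasDerivWithinAt (fun t' => star (P t' s))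
      (star (P t s) * Γ (H t s) (Ht t s)) (Icc (0:ℝ) 1) t := by
    intro s hs t ht
    refine (hPt s hs t ht).star.congr_deriv ?_
    change star (-(Γ (H t s) (Ht t s) * P t s)) = _
    rw [star_neg, star_mul, hstar _ (hHΩ s hs t ht)]
    simp
  have hone : ∀ s ∈ J, P 1 s = 1 := hP1
  have hQP : ∀ s ∈ J, ∀ t ∈ Icc (0:ℝ) 1, star (P t s) * P t s = 1 := by
    intro s hs
    have hd : ∀ t ∈ Icc (0:ℝ) 1, HasDerivWithinAt (fun t' => star (P t' s) * P t' s) 0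
        (Icc (0:ℝ) 1) t := by
      intro t ht
      refine ((hQd s hs t ht).mul (hPt s hs t ht)).congr_deriv ?_
      change star (P t s) * Γ (H t s) (Ht t s) * P t s
        + star (P t s) * (-(Γ (H t s) (Ht t s) * P t s)) = 0
      noncomm_ring
    have hc := constant_of_has_deriv_right_zero (fun t ht => (hd t ht).continuousWithinAt)
      (fun t ht => ((hd t (Ico_subset_Icc_self ht)).mono_of_mem_nhdsWithin
        (Icc_mem_nhdsGE_of_mem ht)))
    intro t ht
    have h1 := hc 1 (by simp)
    rw [hc t ht, ← h1, hone s hs]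
    simp
  have hPQ : ∀ s ∈ J, ∀ t ∈ Icc (0:ℝ) 1, P t s * star (P t s) = 1 := by
    intro s hs t ht
    have h1 := hQP s hs t ht
    have h2 : (star (P t s)).toLinearMap * (P t s).toLinearMap = 1 := by
      ext u; exact congrArg (fun T : F →L[ℝ] F => T u) h1
    have h3 := mul_eq_one_comm.1 h2
    ext u; exact congrArg (fun T : F →ₗ[ℝ] F => T u) h3
  refine ⟨fun t s => star (P t s), fun s hs t ht => ⟨hQP s hs t ht, hPQ s hs t ht⟩, ?_⟩
  intro s hs
  have hcore := ptaux_core Ω Γ DΓ hΓ hDΓcont J hJ H Ht Hs hHΩ hHt hHs hHtcont hHscont P Ps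
    hPt hPs hPcont s hs (fun t => P 0 s * star (P t s))
    (fun t ht => ((hQd s hs t ht).const_mul (P 0 s)).congr_deriv (mul_assoc _ _ _).symm)
  have hPs1 : Ps 1 s = 0 := by
    refine (hPs s hs 1 (by simp)).unique ?_
    refine (hasDerivAt_const s (1 : F →L[ℝ] F)).congr_of_eventuallyEq ?_
    filter_upwards [hJ.mem_nhds hs] with x hx using hone x hx
  have h0 := hPQ s hs 0 (by simp)
  simp only [hPs1, hone s hs, h0, star_one, one_mul, mul_one, add_zero] at hcore
  change Ps 0 s + Γ (H 0 s) (Hs 0 s) * P 0 s - P 0 s * Γ (H 1 s) (Hs 1 s)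
    = ∫ t in (0:ℝ)..1, P 0 s * (star (P t s) * (((DΓ (H t s) (Hs t s) (Ht t s)
      - DΓ (H t s) (Ht t s) (Hs t s) + Γ (H t s) (Hs t s) * Γ (H t s) (Ht t s)
      - Γ (H t s) (Ht t s) * Γ (H t s) (Hs t s))) * P t s))
  have hL : Ps 0 s + Γ (H 0 s) (Hs 0 s) * P 0 s - P 0 s * Γ (H 1 s) (Hs 1 s)
    = -(P 0 s * Γ (H 1 s) (Hs 1 s) - (Γ (H 0 s) (Hs 0 s) * P 0 s + Ps 0 s)) := by abel
  rw [hL, ← hcore, ← intervalIntegral.integral_neg]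
  refine intervalIntegral.integral_congr fun t _ => ?_
  noncomm_ring
end

section
/- Let F be a finite-dimensional real inner product space, Ω ⊆ ℝ^N open, Γ ∈ C¹(Ω, L(ℝ^N, o(F))) a connection form, J ⊆ ℝ open, and H ∈ C¹([0,1]×J, Ω); write γ_s = H(·,s). Let P : [0,1]×J → L(F,F) be C¹ and suppose that for each s ∈ J the map t ↦ P(t,s) satisfies ∂_t P(t,s) = −Γ(γ_s(t))[∂_t γ_s(t)] ∘ P(t,s) and P(1,s) = id_F. Then, for all s ∈ J, in the operator norm on L(F,F): ‖∂_s P(0,s) + Γ(γ_s(0))[∂_s γ_s(0)] ∘ P(0,s) − P(0,s) ∘ Γ(γ_s(1))[∂_s γ_s(1)]‖ ≤ ∫₀¹ ‖K_Γ(γ_s(t))[∂_s γ_s(t), ∂_t γ_s(t)]‖ dt. -/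
open Set intervalIntegral
open scoped RealInnerProductSpace

lemma ptd_local {E : Type*} [NormedAddCommGroup E] [NormedSpace ℝ E]
    {I J : Set ℝ} (hJ : IsOpen J) {f f' : ℝ → ℝ → E}
    (hfs : ∀ s ∈ J, ∀ t ∈ I, HasDerivAt (fun s' => f t s') (f' t s) s)
    (hc : ContinuousOn (fun q : ℝ × ℝ => f' q.1 q.2) (I ×ˢ J))
    {t0 s0 : ℝ} (ht0 : t0 ∈ I) (hs0 : s0 ∈ J) {ε : ℝ} (hε : 0 < ε) :
    ∃ δ > 0, ∀ t ∈ I, dist t t0 < δ → ∀ a ∈ Metric.ball s0 δ, ∀ b ∈ Metric.ball s0 δ,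
      ‖f t b - f t a - (b - a) • f' t0 s0‖ ≤ ε * ‖b - a‖ := by
  obtain ⟨δ1, hδ1, hb⟩ := Metric.isOpen_iff.1 hJ s0 hs0
  have h1 := Metric.continuousWithinAt_iff.1 (hc (t0, s0) ⟨ht0, hs0⟩) ε hε
  obtain ⟨δ2, hδ2, h2⟩ := h1
  refine ⟨min δ1 δ2, lt_min hδ1 hδ2, fun t ht htt a ha b hb' => ?_⟩
  have key := (convex_ball s0 (min δ1 δ2)).norm_image_sub_le_of_norm_hasDerivWithin_le
    (f := fun x => f t x - x • f' t0 s0) (f' := fun x => f' t x - (1:ℝ) • f' t0 s0) (C := ε)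
    (x := a) (y := b) ?_ ?_ ha hb'
  · have e : f t b - f t a - (b - a) • f' t0 s0
        = (f t b - b • f' t0 s0) - (f t a - a • f' t0 s0) := by
      rw [sub_smul]; abel
    rw [e]; exact key
  · intro x hx
    have hxJ : x ∈ J := hb (Metric.ball_subset_ball (min_le_left _ _) hx)
    exact ((hfs x hxJ t ht).sub ((hasDerivAt_id x).smul_const _)).hasDerivWithinAt
  · intro x hx
    have hxJ : x ∈ J := hb (Metric.ball_subset_ball (min_le_left _ _) hx)
    have := h2 (x := (t, x)) ⟨ht, hxJ⟩ (by
      rw [Prod.dist_eq]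
      exact max_lt (htt.trans_le (min_le_right _ _))
        ((Metric.mem_ball.1 hx).trans_le (min_le_right _ _)))
    rw [dist_eq_norm] at this
    simpa using this.le

lemma ptd_joint {E : Type*} [NormedAddCommGroup E] [NormedSpace ℝ E]
    {I J : Set ℝ} (hJ : IsOpen J) {f f' : ℝ → ℝ → E}
    (hft : ∀ s ∈ J, ContinuousOn (fun t => f t s) I)
    (hfs : ∀ s ∈ J, ∀ t ∈ I, HasDerivAt (fun s' => f t s') (f' t s) s)
    (hc : ContinuousOn (fun q : ℝ × ℝ => f' q.1 q.2) (I ×ˢ J)) :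
    ContinuousOn (fun q : ℝ × ℝ => f q.1 q.2) (I ×ˢ J) := by
  rintro ⟨t0, s0⟩ ⟨ht0, hs0⟩
  simp only at ht0 hs0
  obtain ⟨δ, hδ, h⟩ := ptd_local hJ hfs hc ht0 hs0 one_pos
  have hA : Filter.Tendsto (fun q : ℝ × ℝ => f q.1 s0) (nhdsWithin (t0, s0) (I ×ˢ J))
      (nhds (f t0 s0)) := by
    have h1 := hft s0 hs0 t0 ht0
    refine Filter.Tendsto.comp h1 ?_
    refine tendsto_nhdsWithin_iff.2 ⟨?_, ?_⟩
    · exact (continuous_fst.tendsto (t0, s0)).mono_left nhdsWithin_le_nhds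
    · filter_upwards [self_mem_nhdsWithin] with q hq using hq.1
  have hB : Filter.Tendsto (fun q : ℝ × ℝ => f q.1 q.2 - f q.1 s0)
      (nhdsWithin (t0, s0) (I ×ˢ J)) (nhds 0) := by
    have hlim : Filter.Tendsto (fun q : ℝ × ℝ => (1 + ‖f' t0 s0‖) * ‖q.2 - s0‖)
      (nhdsWithin (t0, s0) (I ×ˢ J)) (nhds 0) := by
      have : Continuous (fun q : ℝ × ℝ => (1 + ‖f' t0 s0‖) * ‖q.2 - s0‖) := by fun_prop
      have h2 := (this.tendsto (t0, s0)).mono_left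
        (nhdsWithin_le_nhds (s := I ×ˢ J))
      simpa using h2
    refine squeeze_zero_norm' ?_ hlim
    have hm : ∀ᶠ q in nhdsWithin (t0, s0) (I ×ˢ J), dist q (t0, s0) < δ :=
      nhdsWithin_le_nhds (Metric.ball_mem_nhds _ hδ)
    filter_upwards [self_mem_nhdsWithin, hm] with q hq hqd
    rw [Prod.dist_eq, max_lt_iff] at hqd
    have h3 := h q.1 hq.1 hqd.1 s0 (Metric.mem_ball_self hδ) q.2 hqd.2
    have h4 := norm_add_le (f q.1 q.2 - f q.1 s0 - (q.2 - s0) • f' t0 s0) ((q.2 - s0) • f' t0 s0)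
    rw [sub_add_cancel, norm_smul] at h4
    nlinarith
  have := hB.add hA
  simpa [ContinuousWithinAt] using this

lemma ptd_dslope {E : Type*} [NormedAddCommGroup E] [NormedSpace ℝ E]
    {I J : Set ℝ} (hJ : IsOpen J) {f f' : ℝ → ℝ → E}
    (hft : ∀ s ∈ J, ContinuousOn (fun t => f t s) I)
    (hfs : ∀ s ∈ J, ∀ t ∈ I, HasDerivAt (fun s' => f t s') (f' t s) s)
    (hc : ContinuousOn (fun q : ℝ × ℝ => f' q.1 q.2) (I ×ˢ J)) {s : ℝ} (hs : s ∈ J) :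
    ContinuousOn (fun q : ℝ × ℝ => dslope (fun s' => f q.1 s') s q.2) (I ×ˢ J) := by
  have hj := ptd_joint hJ hft hfs hc
  rintro ⟨t0, s0⟩ ⟨ht0, hs0⟩
  simp only at ht0 hs0
  by_cases hss : s0 = s
  · subst hss
    rw [Metric.continuousWithinAt_iff]
    intro ε hε
    obtain ⟨δ, hδ, h⟩ := ptd_local hJ hfs hc ht0 hs0 (half_pos hε)
    refine ⟨δ, hδ, fun q hq hqd => ?_⟩
    rw [Prod.dist_eq, max_lt_iff] at hqd
    simp only [dslope_same, (hfs s0 hs0 t0 ht0).deriv]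
    rw [dist_eq_norm]
    by_cases hq2 : q.2 = s0
    · rw [hq2, dslope_same]
      have hd := (hfs s0 hs0 q.1 hq.1)
      rw [hd.deriv]
      have hsub : HasDerivAt (fun x => f q.1 x - x • f' t0 s0) (f' q.1 s0 - (1:ℝ) • f' t0 s0) s0 :=
        hd.sub ((hasDerivAt_id s0).smul_const _)
      have hle := hsub.le_of_lip' (C := ε / 2) (half_pos hε).le (by
        filter_upwards [Metric.ball_mem_nhds s0 hδ] with x hx
        have := h q.1 hq.1 hqd.1 s0 (Metric.mem_ball_self hδ) x hx
        have e : f q.1 x - f q.1 s0 - (x - s0) • f' t0 s0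
            = (f q.1 x - x • f' t0 s0) - (f q.1 s0 - s0 • f' t0 s0) := by
          rw [sub_smul]; abel
        rwa [e] at this)
      simp only [one_smul] at hle
      have : ‖f' q.1 s0 - f' t0 s0‖ ≤ ε / 2 := by simpa using hle
      linarith
    · rw [dslope_of_ne _ hq2, slope_def_module]
      have h3 := h q.1 hq.1 hqd.1 s0 (Metric.mem_ball_self hδ) q.2 hqd.2
      have hne : q.2 - s0 ≠ 0 := sub_ne_zero.2 hq2
      have e : (q.2 - s0)⁻¹ • (f q.1 q.2 - f q.1 s0) - f' t0 s0
          = (q.2 - s0)⁻¹ • (f q.1 q.2 - f q.1 s0 - (q.2 - s0) • f' t0 s0) := by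
        rw [smul_sub _ _ ((q.2 - s0) • f' t0 s0), smul_smul, inv_mul_cancel₀ hne, one_smul]
      rw [e, norm_smul, norm_inv]
      have hp : 0 < ‖q.2 - s0‖ := norm_pos_iff.2 hne
      calc ‖q.2 - s0‖⁻¹ * _ ≤ ‖q.2 - s0‖⁻¹ * (ε / 2 * ‖q.2 - s0‖) := by gcongr
        _ = ε / 2 := by field_simp
        _ < ε := by linarith
  · have hev : ∀ᶠ q : ℝ × ℝ in nhdsWithin (t0, s0) (I ×ˢ J), q.2 ≠ s :=
      nhdsWithin_le_nhds ((continuous_snd.tendsto (t0, s0)).eventually_ne hss)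
    have hcs : ContinuousWithinAt (fun q : ℝ × ℝ => (q.2 - s)⁻¹ • (f q.1 q.2 - f q.1 s))
        (I ×ˢ J) (t0, s0) := by
      refine ContinuousWithinAt.smul (ContinuousWithinAt.inv₀ (by fun_prop) (sub_ne_zero.2 hss))
        ((hj (t0, s0) ⟨ht0, hs0⟩).sub ?_)
      have h1 := hft s hs t0 ht0
      exact ContinuousWithinAt.comp (f := fun q : ℝ × ℝ => q.1) (t := I) (x := (t0, s0)) h1
        (by fun_prop) (fun q hq => hq.1)
    refine hcs.congr_of_eventuallyEq ?_ ?_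
    · filter_upwards [hev] with q hq
      rw [dslope_of_ne _ hq, slope_def_module]
    · simp only
      rw [dslope_of_ne _ hss, slope_def_module]

lemma ptd_integral {E : Type*} [NormedAddCommGroup E] [NormedSpace ℝ E]
    {J : Set ℝ} (hJ : IsOpen J) {g : ℝ × ℝ → E} (hg : ContinuousOn g (Icc (0:ℝ) 1 ×ˢ J))
    {s : ℝ} (hs : s ∈ J) :
    ContinuousAt (fun s' => ∫ t in (0:ℝ)..1, g (t, s')) s := by
  obtain ⟨δ, hδ, hb⟩ := Metric.nhds_basis_closedBall.mem_iff.1 (hJ.mem_nhds hs)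
  have hcomp : IsCompact (Icc (0:ℝ) 1 ×ˢ Metric.closedBall s δ) :=
    isCompact_Icc.prod (isCompact_closedBall s δ)
  obtain ⟨C, hC⟩ := hcomp.exists_bound_of_continuousOn (hg.mono (prod_mono le_rfl hb))
  have hsub : Set.uIoc (0:ℝ) 1 ⊆ Icc 0 1 := by
    rw [uIoc_of_le zero_le_one]; exact Ioc_subset_Icc_self
  have hslice : ∀ s' ∈ J, ContinuousOn (fun t => g (t, s')) (Icc (0:ℝ) 1) := fun s' hs' =>
    hg.comp (f := fun t : ℝ => (t, s')) (by fun_prop) (fun t ht => ⟨ht, hs'⟩)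
  refine continuousAt_of_dominated_interval (bound := fun _ => C) ?_ ?_ (by simp) ?_
  · filter_upwards [hJ.mem_nhds hs] with s' hs'
    exact ((hslice s' hs').mono hsub).aestronglyMeasurable measurableSet_uIoc
  · filter_upwards [Metric.closedBall_mem_nhds s hδ] with s' hs'
    exact Filter.Eventually.of_forall fun t ht => hC _ ⟨hsub ht, hs'⟩
  · refine Filter.Eventually.of_forall fun t ht => ?_
    have : ContinuousOn (fun s' => g (t, s')) J :=
      hg.comp (f := fun s' : ℝ => (t, s')) (by fun_prop) (fun s' hs' => ⟨hsub ht, hs'⟩)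
    exact this.continuousAt (hJ.mem_nhds hs)

lemma ptd_core {𝔸 E : Type*} [NormedRing 𝔸] [NormedAlgebra ℝ 𝔸] [CompleteSpace 𝔸]
    [NormedAddCommGroup E] [NormedSpace ℝ E]
    (Ω : Set E)
    (Γ : E → E →L[ℝ] 𝔸) (DΓ : E → E →L[ℝ] E →L[ℝ] 𝔸)
    (hΓ : ∀ x ∈ Ω, HasFDerivAt Γ (DΓ x) x)
    (hDΓcont : ContinuousOn DΓ Ω)
    (J : Set ℝ) (hJ : IsOpen J)
    (H Ht Hs : ℝ → ℝ → E)
    (hHΩ : ∀ s ∈ J, ∀ t ∈ Icc (0:ℝ) 1, H t s ∈ Ω)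
    (hHt : ∀ s ∈ J, ∀ t ∈ Icc (0:ℝ) 1,
      HasDerivWithinAt (fun t' => H t' s) (Ht t s) (Icc (0:ℝ) 1) t)
    (hHs : ∀ s ∈ J, ∀ t ∈ Icc (0:ℝ) 1, HasDerivAt (fun s' => H t s') (Hs t s) s)
    (hHtcont : ContinuousOn (fun q : ℝ × ℝ => Ht q.1 q.2) (Icc (0:ℝ) 1 ×ˢ J))
    (hHscont : ContinuousOn (fun q : ℝ × ℝ => Hs q.1 q.2) (Icc (0:ℝ) 1 ×ˢ J))
    (P Ps : ℝ → ℝ → 𝔸)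
    (hPt : ∀ s ∈ J, ∀ t ∈ Icc (0:ℝ) 1,
      HasDerivWithinAt (fun t' => P t' s)
        (-((Γ (H t s)) (Ht t s) * (P t s))) (Icc (0:ℝ) 1) t)
    (hPs : ∀ s ∈ J, ∀ t ∈ Icc (0:ℝ) 1, HasDerivAt (fun s' => P t s') (Ps t s) s)
    (hPscont : ContinuousOn (fun q : ℝ × ℝ => Ps q.1 q.2) (Icc (0:ℝ) 1 ×ˢ J))
    (s : ℝ) (hs : s ∈ J) (R : ℝ → 𝔸)
    (hR : ∀ t ∈ Icc (0:ℝ) 1,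
      HasDerivWithinAt R (R t * (Γ (H t s)) (Ht t s)) (Icc (0:ℝ) 1) t) :
    ContinuousOn (fun t => DΓ (H t s) (Hs t s) (Ht t s) - DΓ (H t s) (Ht t s) (Hs t s)
        + Γ (H t s) (Hs t s) * Γ (H t s) (Ht t s) - Γ (H t s) (Ht t s) * Γ (H t s) (Hs t s))
        (Icc (0:ℝ) 1) ∧
    ∫ t in (0:ℝ)..1, R t * ((DΓ (H t s) (Hs t s) (Ht t s) - DΓ (H t s) (Ht t s) (Hs t s)
        + Γ (H t s) (Hs t s) * Γ (H t s) (Ht t s) - Γ (H t s) (Ht t s) * Γ (H t s) (Hs t s))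
        * P t s)
      = R 0 * (Ps 0 s + Γ (H 0 s) (Hs 0 s) * P 0 s)
        - R 1 * (Ps 1 s + Γ (H 1 s) (Hs 1 s) * P 1 s) := by
  have h0 : (0:ℝ) ∈ Icc (0:ℝ) 1 := by simp
  have h1 : (1:ℝ) ∈ Icc (0:ℝ) 1 := by simp
  have hHc := ptd_joint hJ (fun s hs t ht => (hHt s hs t ht).continuousWithinAt) hHs hHscont
  have hPc := ptd_joint hJ (fun s hs t ht => (hPt s hs t ht).continuousWithinAt) hPs hPscont
  have hmap : MapsTo (fun q : ℝ × ℝ => H q.1 q.2) (Icc (0:ℝ) 1 ×ˢ J) Ω :=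
    fun q hq => hHΩ q.2 hq.2 q.1 hq.1
  have hDc : ContinuousOn (fun q : ℝ × ℝ => DΓ (H q.1 q.2)) (Icc (0:ℝ) 1 ×ˢ J) :=
    hDΓcont.comp hHc hmap
  have hΓcont : ContinuousOn Γ Ω := fun x hx => (hΓ x hx).continuousAt.continuousWithinAt
  have hΓc : ContinuousOn (fun q : ℝ × ℝ => Γ (H q.1 q.2)) (Icc (0:ℝ) 1 ×ˢ J) :=
    hΓcont.comp hHc hmap
  have hΓs : ∀ s ∈ J, ∀ t ∈ Icc (0:ℝ) 1,
      HasDerivAt (fun s' => Γ (H t s')) (DΓ (H t s) (Hs t s)) s := fun s hs t ht =>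
    (hΓ _ (hHΩ s hs t ht)).comp_hasDerivAt s (hHs s hs t ht)
  have hΓt : ∀ s ∈ J, ∀ t ∈ Icc (0:ℝ) 1,
      HasDerivWithinAt (fun t' => Γ (H t' s)) (DΓ (H t s) (Ht t s)) (Icc (0:ℝ) 1) t :=
    fun s hs t ht => (hΓ _ (hHΩ s hs t ht)).comp_hasDerivWithinAt t (hHt s hs t ht)
  have hD1 := ptd_dslope hJ (fun s hs t ht => (hHt s hs t ht).continuousWithinAt) hHs hHscont hs
  have hD2 := ptd_dslope hJ (f := fun t s => Γ (H t s)) (f' := fun t s => DΓ (H t s) (Hs t s))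
    (fun s hs t ht => (hΓt s hs t ht).continuousWithinAt) hΓs (hDc.clm_apply hHscont) hs
  have hD3 := ptd_dslope hJ (fun s hs t ht => (hPt s hs t ht).continuousWithinAt) hPs hPscont hs
  have hRc : ContinuousOn R (Icc (0:ℝ) 1) := fun t ht => (hR t ht).continuousWithinAt
  have hfst : MapsTo (fun q : ℝ × ℝ => q.1) (Icc (0:ℝ) 1 ×ˢ J) (Icc (0:ℝ) 1) := fun q hq => hq.1
  have hslice : MapsTo (fun q : ℝ × ℝ => (q.1, s)) (Icc (0:ℝ) 1 ×ˢ J) (Icc (0:ℝ) 1 ×ˢ J) :=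
    fun q hq => ⟨hq.1, hs⟩
  have hsl : ContinuousOn (fun q : ℝ × ℝ => (q.1, s)) (Icc (0:ℝ) 1 ×ˢ J) := by fun_prop
  have hRc2 : ContinuousOn (fun q : ℝ × ℝ => R q.1) (Icc (0:ℝ) 1 ×ˢ J) :=
    hRc.comp continuousOn_fst hfst
  have hΓ0 : ContinuousOn (fun q : ℝ × ℝ => Γ (H q.1 s)) (Icc (0:ℝ) 1 ×ˢ J) :=
    hΓc.comp hsl hslice
  have hDΓ0 : ContinuousOn (fun q : ℝ × ℝ => DΓ (H q.1 s)) (Icc (0:ℝ) 1 ×ˢ J) :=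
    hDc.comp hsl hslice
  have hHt0 : ContinuousOn (fun q : ℝ × ℝ => Ht q.1 s) (Icc (0:ℝ) 1 ×ˢ J) :=
    hHtcont.comp hsl hslice
  have hP0 : ContinuousOn (fun q : ℝ × ℝ => P q.1 s) (Icc (0:ℝ) 1 ×ˢ J) :=
    hPc.comp hsl hslice
  set D1 : ℝ × ℝ → E := fun q => dslope (fun s' => H q.1 s') s q.2 with hD1def
  set D2 : ℝ × ℝ → E →L[ℝ] 𝔸 := fun q => dslope (fun s' => Γ (H q.1 s')) s q.2 with hD2def
  set D3 : ℝ × ℝ → 𝔸 := fun q => dslope (fun s' => P q.1 s') s q.2 with hD3def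
  let G : ℝ × ℝ → 𝔸 := fun q => R q.1 *
    ((Γ (H q.1 s) (Ht q.1 s) * Γ (H q.1 s) (D1 q) - Γ (H q.1 s) (D1 q) * Γ (H q.1 s) (Ht q.1 s))
        * P q.1 s
      + DΓ (H q.1 s) (Ht q.1 s) (D1 q) * P q.1 s
      - D2 q (Ht q.1 q.2) * P q.1 q.2
      - Γ (H q.1 s) (Ht q.1 q.2 - Ht q.1 s) * D3 q)
  let Q : ℝ × ℝ → 𝔸 := fun q => R q.1 * (D3 q + Γ (H q.1 s) (D1 q) * P q.1 s)
  have hGc : ContinuousOn G (Icc (0:ℝ) 1 ×ˢ J) := by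
    have a1 := hΓ0.clm_apply hHt0
    have a2 := hΓ0.clm_apply hD1
    have a3 := (hDΓ0.clm_apply hHt0).clm_apply hD1
    have a4 := hD2.clm_apply hHtcont
    have a5 := hΓ0.clm_apply (hHtcont.sub hHt0)
    exact hRc2.mul (((((a1.mul a2).sub (a2.mul a1)).mul hP0).add (a3.mul hP0)).sub
      (a4.mul hPc) |>.sub (a5.mul hD3))
  have hQc : ContinuousOn Q (Icc (0:ℝ) 1 ×ˢ J) :=
    hRc2.mul (hD3.add ((hΓ0.clm_apply hD1).mul hP0))
  have hft : ∀ s' ∈ J, ∀ g : ℝ × ℝ → 𝔸, ContinuousOn g (Icc (0:ℝ) 1 ×ˢ J) →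
      ContinuousOn (fun t => g (t, s')) (Icc (0:ℝ) 1) := fun s' hs' g hg =>
    hg.comp (f := fun t : ℝ => (t, s')) (by fun_prop) (fun t ht => ⟨ht, hs'⟩)
  have hne : ∀ s' ∈ J, s' ≠ s → ∫ t in (0:ℝ)..1, G (t, s') = Q (1, s') - Q (0, s') := by
    intro s' hs' hss
    refine integral_eq_sub_of_hasDerivAt_of_le zero_le_one (hft s' hs' Q hQc) ?_ ?_
    · intro t ht
      have htI := Ioo_subset_Icc_self ht
      refine HasDerivWithinAt.hasDerivAt (s := Icc (0:ℝ) 1) ?_ (Icc_mem_nhds ht.1 ht.2)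
      have d3 : HasDerivWithinAt (fun t => D3 (t, s'))
          ((s' - s)⁻¹ • (-(Γ (H t s') (Ht t s') * P t s') - -(Γ (H t s) (Ht t s) * P t s))) (Icc (0:ℝ) 1) t := by
        have := ((hPt s' hs' t htI).sub (hPt s hs t htI)).const_smul (s' - s)⁻¹
        refine this.congr_of_mem (fun x hx => ?_) htI
        simp [hD3def, dslope_of_ne _ hss, slope_def_module]
      have d1 : HasDerivWithinAt (fun t => D1 (t, s'))
          ((s' - s)⁻¹ • (Ht t s' - Ht t s)) (Icc (0:ℝ) 1) t := by
        have := ((hHt s' hs' t htI).sub (hHt s hs t htI)).const_smul (s' - s)⁻¹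
        refine this.congr_of_mem (fun x hx => ?_) htI
        simp [hD1def, dslope_of_ne _ hss, slope_def_module]
      have d := (hR t htI).mul (d3.add (((hΓt s hs t htI).clm_apply d1).mul (hPt s hs t htI)))
      refine d.congr_deriv ?_
      have e2 : D2 (t, s') = (s' - s)⁻¹ • (Γ (H t s') - Γ (H t s)) := by
        simp [hD2def, dslope_of_ne _ hss, slope_def_module]
      have e3 : D3 (t, s') = (s' - s)⁻¹ • (P t s' - P t s) := by
        simp [hD3def, dslope_of_ne _ hss, slope_def_module]
      simp only [G, Pi.add_apply, Pi.mul_apply, e2, e3]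
      generalize D1 (t, s') = d1'
      simp only [map_sub, map_smul, smul_apply, sub_apply,
        mul_add, add_mul, mul_sub, sub_mul, smul_mul_assoc, mul_smul_comm, smul_sub, mul_neg,
        neg_mul, ← mul_assoc, smul_neg]
      module
    · exact ContinuousOn.intervalIntegrable_of_Icc zero_le_one (hft s' hs' G hGc)
  have hQs : ∀ t ∈ Icc (0:ℝ) 1, ContinuousAt (fun s' => Q (t, s')) s := fun t ht =>
    (hQc.comp (f := fun s' : ℝ => (t, s')) (by fun_prop)
      (fun s' hs' => ⟨ht, hs'⟩)).continuousAt (hJ.mem_nhds hs)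
  have hmain : ∫ t in (0:ℝ)..1, G (t, s) = Q (1, s) - Q (0, s) := by
    have l1 := (ptd_integral hJ hGc hs).tendsto.mono_left (nhdsWithin_le_nhds (s := {s}ᶜ))
    have l2 := ((hQs 1 h1).sub (hQs 0 h0)).tendsto.mono_left (nhdsWithin_le_nhds (s := {s}ᶜ))
    refine tendsto_nhds_unique l1 (l2.congr' ?_)
    filter_upwards [self_mem_nhdsWithin, nhdsWithin_le_nhds (hJ.mem_nhds hs)] with s' hs1 hs2
    exact (hne s' hs2 hs1).symm
  have f1 : ∀ t ∈ Icc (0:ℝ) 1, D1 (t, s) = Hs t s := fun t ht => by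
    simp [hD1def, (hHs s hs t ht).deriv]
  have f2 : ∀ t ∈ Icc (0:ℝ) 1, D2 (t, s) = DΓ (H t s) (Hs t s) := fun t ht => by
    simp [hD2def, (hΓs s hs t ht).deriv]
  have f3 : ∀ t ∈ Icc (0:ℝ) 1, D3 (t, s) = Ps t s := fun t ht => by
    simp [hD3def, (hPs s hs t ht).deriv]
  refine ⟨?_, ?_⟩
  · have b1 := hΓc.clm_apply hHtcont
    have b2 := hΓc.clm_apply hHscont
    have b3 := (hDc.clm_apply hHscont).clm_apply hHtcont
    have b4 := (hDc.clm_apply hHtcont).clm_apply hHscont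
    exact hft s hs _ (((b3.sub b4).add (b2.mul b1)).sub (b1.mul b2))
  · have hflip := congrArg Neg.neg hmain
    rw [← intervalIntegral.integral_neg, neg_sub] at hflip
    simp only [Q, f1 0 h0, f1 1 h1, f3 0 h0, f3 1 h1] at hflip
    rw [← hflip]
    refine intervalIntegral.integral_congr fun t ht => ?_
    rw [uIcc_of_le zero_le_one] at ht
    simp only [G, f1 t ht, f2 t ht, f3 t ht]
    simp only [sub_self, map_zero, zero_mul, sub_zero]
    noncomm_ring

set_option synthInstance.maxHeartbeats 1000000
set_option maxHeartbeats 1000000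

/-- Holonomy estimate for the derivative of parallel transport with
respect to a parameter, in the operator norm:
`‖∂ₛ P(0,s) + Γ(γₛ(0))[∂ₛγₛ(0)] ∘ P(0,s) − P(0,s) ∘ Γ(γₛ(1))[∂ₛγₛ(1)]‖
  ≤ ∫₀¹ ‖K_Γ(γₛ(t))[∂ₛγₛ(t), ∂ₜγₛ(t)]‖ dt`. -/
theorem parallel_transport_parameter_derivative_norm_estimate
    {F : Type*} [NormedAddCommGroup F] [InnerProductSpace ℝ F] [FiniteDimensional ℝ F]
    {N : ℕ}
    (Ω : Set (EuclideanSpace ℝ (Fin N))) (hΩ : IsOpen Ω)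
    -- Γ of class C¹ on Ω with derivative DΓ, with skew-adjoint values
    (Γ : EuclideanSpace ℝ (Fin N) → EuclideanSpace ℝ (Fin N) →L[ℝ] F →L[ℝ] F)
    (DΓ : EuclideanSpace ℝ (Fin N) →
      EuclideanSpace ℝ (Fin N) →L[ℝ] EuclideanSpace ℝ (Fin N) →L[ℝ] F →L[ℝ] F)
    (hΓ : ∀ x ∈ Ω, HasFDerivAt Γ (DΓ x) x)
    (hDΓcont : ContinuousOn DΓ Ω)
    (hskew : ∀ x ∈ Ω, ∀ (v : EuclideanSpace ℝ (Fin N)) (u w : F),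
      ⟪(Γ x v) u, w⟫ = -⟪u, (Γ x v) w⟫)
    -- the C¹ family of paths H(t, s) = γₛ(t), with partial derivatives Ht, Hs
    (J : Set ℝ) (hJ : IsOpen J)
    (H Ht Hs : ℝ → ℝ → EuclideanSpace ℝ (Fin N))
    (hHΩ : ∀ s ∈ J, ∀ t ∈ Icc (0:ℝ) 1, H t s ∈ Ω)
    (hHt : ∀ s ∈ J, ∀ t ∈ Icc (0:ℝ) 1,
      HasDerivWithinAt (fun t' => H t' s) (Ht t s) (Icc (0:ℝ) 1) t)
    (hHs : ∀ s ∈ J, ∀ t ∈ Icc (0:ℝ) 1, HasDerivAt (fun s' => H t s') (Hs t s) s)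
    (hHtcont : ContinuousOn (fun q : ℝ × ℝ => Ht q.1 q.2) (Icc (0:ℝ) 1 ×ˢ J))
    (hHscont : ContinuousOn (fun q : ℝ × ℝ => Hs q.1 q.2) (Icc (0:ℝ) 1 ×ˢ J))
    -- the C¹ family of parallel transports P(t,s) with partial derivative ∂ₛP = Ps
    (P Ps : ℝ → ℝ → F →L[ℝ] F)
    (hPt : ∀ s ∈ J, ∀ t ∈ Icc (0:ℝ) 1,
      HasDerivWithinAt (fun t' => P t' s)
        (-((Γ (H t s)) (Ht t s)).comp (P t s)) (Icc (0:ℝ) 1) t)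
    (hP1 : ∀ s ∈ J, P 1 s = ContinuousLinearMap.id ℝ F)
    (hPs : ∀ s ∈ J, ∀ t ∈ Icc (0:ℝ) 1, HasDerivAt (fun s' => P t s') (Ps t s) s)
    (hPcont : ContinuousOn (fun q : ℝ × ℝ => P q.1 q.2) (Icc (0:ℝ) 1 ×ˢ J))
    (hPscont : ContinuousOn (fun q : ℝ × ℝ => Ps q.1 q.2) (Icc (0:ℝ) 1 ×ˢ J)) :
    ∀ s ∈ J,
      ‖Ps 0 s + ((Γ (H 0 s)) (Hs 0 s)).comp (P 0 s)
          - (P 0 s).comp ((Γ (H 1 s)) (Hs 1 s))‖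
        ≤ ∫ t in (0:ℝ)..1,
            ‖((DΓ (H t s)) (Hs t s)) (Ht t s) - ((DΓ (H t s)) (Ht t s)) (Hs t s)
              + ((Γ (H t s)) (Hs t s)).comp ((Γ (H t s)) (Ht t s))
              - ((Γ (H t s)) (Ht t s)).comp ((Γ (H t s)) (Hs t s))‖ := by
  intro s hs
  have : CompleteSpace F := FiniteDimensional.complete ℝ F
  have h0 : (0:ℝ) ∈ Icc (0:ℝ) 1 := by simp
  have h1 : (1:ℝ) ∈ Icc (0:ℝ) 1 := by simp
  have hstar : ∀ t ∈ Icc (0:ℝ) 1,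
      star ((Γ (H t s)) (Ht t s)) = -((Γ (H t s)) (Ht t s)) := by
    intro t ht
    rw [ContinuousLinearMap.star_eq_adjoint]
    symm
    rw [ContinuousLinearMap.eq_adjoint_iff]
    intro x y
    have := hskew _ (hHΩ s hs t ht) (Ht t s) x y
    simp [inner_neg_left, this]
  have hR : ∀ t ∈ Icc (0:ℝ) 1, HasDerivWithinAt (fun t => star (P t s))
      (star (P t s) * (Γ (H t s)) (Ht t s)) (Icc (0:ℝ) 1) t := by
    intro t ht
    have h := (hPt s hs t ht).star
    refine h.congr_deriv ?_
    change star (-((Γ (H t s)) (Ht t s) * P t s)) = _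
    rw [star_neg, star_mul, hstar t ht, mul_neg, neg_neg]
  have hunit : ∀ t ∈ Icc (0:ℝ) 1, star (P t s) * P t s = 1 := by
    intro t ht
    have hd : ∀ x ∈ Icc (0:ℝ) 1,
        HasDerivWithinAt (fun t => star (P t s) * P t s) 0 (Icc (0:ℝ) 1) x := by
      intro x hx
      refine ((hR x hx).mul (hPt s hs x hx)).congr_deriv ?_
      change star (P x s) * (Γ (H x s)) (Ht x s) * P x s
        + star (P x s) * -((Γ (H x s)) (Ht x s) * P x s) = 0
      noncomm_ring
    have := (convex_Icc (0:ℝ) 1).norm_image_sub_le_of_norm_hasDerivWithin_le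
      (C := 0) hd (by simp) h1 ht
    rw [zero_mul, norm_le_zero_iff, sub_eq_zero] at this
    rw [this, hP1 s hs]
    change star (1 : F →L[ℝ] F) * 1 = 1
    simp
  have hunit' : ∀ t ∈ Icc (0:ℝ) 1, P t s * star (P t s) = 1 := by
    intro t ht
    have h := hunit t ht
    have h2 : (star (P t s)).toLinearMap * (P t s).toLinearMap = 1 := by
      ext x
      exact congrArg (fun L : F →L[ℝ] F => L x) h
    have h3 := mul_eq_one_comm.1 h2
    ext x
    exact congrArg (fun L : F →ₗ[ℝ] F => L x) h3
  have hnorm : ∀ t ∈ Icc (0:ℝ) 1, ‖P t s‖ ≤ 1 := by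
    intro t ht
    have h := CStarRing.norm_star_mul_self (x := P t s)
    rw [hunit t ht] at h
    have h2 : ‖(1 : F →L[ℝ] F)‖ ≤ 1 := ContinuousLinearMap.norm_id_le
    nlinarith [norm_nonneg (P t s)]
  obtain ⟨hKc, hint⟩ := ptd_core (𝔸 := F →L[ℝ] F) Ω Γ DΓ hΓ hDΓcont J hJ H Ht Hs hHΩ hHt hHs
    hHtcont hHscont P Ps hPt hPs hPscont s hs (fun t => star (P t s)) hR
  have hPs1 : Ps 1 s = 0 := by
    have h := hPs s hs 1 h1
    have h2 : HasDerivAt (fun s' => P 1 s') 0 s := by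
      refine (hasDerivAt_const s (ContinuousLinearMap.id ℝ F)).congr_of_eventuallyEq ?_
      filter_upwards [hJ.mem_nhds hs] with s' hs' using hP1 s' hs'
    exact h.unique h2
  have hP1' : P 1 s = 1 := hP1 s hs
  set K : ℝ → F →L[ℝ] F := fun t => DΓ (H t s) (Hs t s) (Ht t s) - DΓ (H t s) (Ht t s) (Hs t s)
        + Γ (H t s) (Hs t s) * Γ (H t s) (Ht t s) - Γ (H t s) (Ht t s) * Γ (H t s) (Hs t s)
    with hK
  have hexp : Ps 0 s + ((Γ (H 0 s)) (Hs 0 s)).comp (P 0 s)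
          - (P 0 s).comp ((Γ (H 1 s)) (Hs 1 s))
      = P 0 s * ∫ t in (0:ℝ)..1, star (P t s) * (K t * P t s) := by
    change Ps 0 s + (Γ (H 0 s)) (Hs 0 s) * P 0 s - P 0 s * (Γ (H 1 s)) (Hs 1 s) = _
    rw [hint, hPs1, hP1', mul_sub, ← mul_assoc, hunit' 0 h0]
    simp
  rw [hexp]
  change _ ≤ ∫ t in (0:ℝ)..1, ‖K t‖
  refine (norm_mul_le _ _).trans ?_
  have hle : ‖∫ t in (0:ℝ)..1, star (P t s) * (K t * P t s)‖ ≤ ∫ t in (0:ℝ)..1, ‖K t‖ := by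
    refine norm_integral_le_of_norm_le zero_le_one ?_
      (ContinuousOn.intervalIntegrable_of_Icc zero_le_one hKc.norm)
    refine Filter.Eventually.of_forall fun t ht => ?_
    have hn := hnorm t (Ioc_subset_Icc_self ht)
    have hns : ‖star (P t s)‖ ≤ 1 := by
      rw [ContinuousLinearMap.star_eq_adjoint, LinearIsometryEquiv.norm_map]; exact hn
    calc ‖star (P t s) * (K t * P t s)‖ ≤ ‖star (P t s)‖ * (‖K t‖ * ‖P t s‖) :=
          (norm_mul_le _ _).trans (by gcongr; exact norm_mul_le _ _)
      _ ≤ 1 * (‖K t‖ * 1) := by gcongr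
      _ = ‖K t‖ := by ring
  calc _ ≤ 1 * ‖∫ t in (0:ℝ)..1, star (P t s) * (K t * P t s)‖ := by
        gcongr; exact hnorm 0 h0
    _ ≤ _ := by rw [one_mul]; exact hle
end

section
/- Let F be a finite-dimensional real inner product space and Γ ∈ C¹(Ω, L(ℝ^N, o(F))) a connection form on an open set Ω ⊆ ℝ^N. Let x, y, z ∈ Ω be such that the closed triangle Δ_{x,y,z} with vertices x, y, z is contained in Ω. Then, in the operator norm on L(F,F), ‖id_F − R^Γ(x,y) ∘ R^Γ(y,z) ∘ R^Γ(z,x)‖ ≤ ‖K_Γ‖_{L∞(Δ_{x,y,z})} · |Δ_{x,y,z}|, where ‖K_Γ‖_{L∞(Δ_{x,y,z})} = sup over w ∈ Δ_{x,y,z} and unit vectors v₁, v₂ ∈ ℝ^N of ‖K_Γ(w)[v₁,v₂]‖, and |Δ_{x,y,z}| = (1/2)·√(‖y−x‖²‖z−x‖² − ⟨y−x, z−x⟩²) is the area of the triangle. -/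
set_option synthInstance.maxHeartbeats 1000000
set_option maxHeartbeats 1000000

open Set
open scoped RealInnerProductSpace

theorem hte_const {E : Type*} [NormedAddCommGroup E] [NormedSpace ℝ E] {f : ℝ → E}
    (hf : ∀ t ∈ Icc (0:ℝ) 1, HasDerivWithinAt f 0 (Icc (0:ℝ) 1) t) :
    ∀ t ∈ Icc (0:ℝ) 1, f t = f 0 := by
  refine constant_of_has_deriv_right_zero (fun t ht => (hf t ht).continuousWithinAt) ?_
  intro t ht
  exact (hf t ⟨ht.1, ht.2.le⟩).mono_of_mem_nhdsWithin (Icc_mem_nhdsGE_of_mem ht)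

theorem hte_isom {F : Type*} [NormedAddCommGroup F] [InnerProductSpace ℝ F]
    {P S : ℝ → F →L[ℝ] F}
    (hS : ∀ t ∈ Icc (0:ℝ) 1, ∀ u₁ u₂ : F, ⟪S t u₁, u₂⟫ = -⟪u₁, S t u₂⟫)
    (hP : ∀ t ∈ Icc (0:ℝ) 1, HasDerivWithinAt P (-(S t * P t)) (Icc (0:ℝ) 1) t) (u : F) :
    ∀ t ∈ Icc (0:ℝ) 1, ‖P t u‖ = ‖P 0 u‖ := by
  have key : ∀ t ∈ Icc (0:ℝ) 1, ⟪P t u, P t u⟫ = ⟪P 0 u, P 0 u⟫ := by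
    refine hte_const (f := fun t => ⟪P t u, P t u⟫) ?_
    intro t ht
    have h1 : HasDerivWithinAt (fun t => P t u) ((-(S t * P t)) u) (Icc (0:ℝ) 1) t :=
      (ContinuousLinearMap.apply ℝ F u).hasFDerivAt.comp_hasDerivWithinAt t (hP t ht)
    have h2 := h1.inner ℝ h1
    refine h2.congr_deriv ?_
    have := hS t ht (P t u) (P t u)
    have e : (-(S t * P t)) u = - S t (P t u) := rfl
    rw [e, inner_neg_left, inner_neg_right, this]
    ring
  intro t ht
  have := key t ht
  rw [real_inner_self_eq_norm_sq, real_inner_self_eq_norm_sq] at this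
  exact (pow_left_inj₀ (norm_nonneg _) (norm_nonneg _) two_ne_zero).1 this

theorem hte_clip {E : Type*} [NormedAddCommGroup E] [NormedSpace ℝ E] (P Q : E) :
    ‖(max 1 ‖P‖)⁻¹ • P - (max 1 ‖Q‖)⁻¹ • Q‖ ≤ 2 * ‖P - Q‖ := by
  set p := max 1 ‖P‖
  set q := max 1 ‖Q‖
  have hp : 1 ≤ p := le_max_left _ _
  have hq : 1 ≤ q := le_max_left _ _
  have hQ : ‖Q‖ ≤ q := le_max_right _ _
  have e : p⁻¹ • P - q⁻¹ • Q = p⁻¹ • (P - Q) + (p⁻¹ - q⁻¹) • Q := by module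
  have hpq : |q - p| ≤ ‖P - Q‖ := by
    have h1 : |q - p| ≤ |‖Q‖ - ‖P‖| := by
      simpa [p, q, max_comm] using abs_max_sub_max_le_abs ‖Q‖ ‖P‖ 1
    have h2 := abs_norm_sub_norm_le Q P
    rw [norm_sub_rev] at h2
    linarith
  rw [e]
  refine (norm_add_le _ _).trans ?_
  rw [norm_smul, norm_smul]
  have a1 : ‖p⁻¹‖ ≤ 1 := by
    rw [Real.norm_eq_abs, abs_of_nonneg (by positivity)]
    exact inv_le_one_of_one_le₀ hp
  have a2 : ‖p⁻¹ - q⁻¹‖ * ‖Q‖ ≤ ‖P - Q‖ := by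
    have : p⁻¹ - q⁻¹ = (q - p) * (p⁻¹ * q⁻¹) := by
      field_simp
    rw [this, norm_mul, Real.norm_eq_abs, Real.norm_eq_abs, abs_of_nonneg (a := p⁻¹ * q⁻¹) (by positivity)]
    have b1 : p⁻¹ * q⁻¹ * ‖Q‖ ≤ 1 := by
      have : q⁻¹ * ‖Q‖ ≤ 1 := by
        rw [inv_mul_le_iff₀ (by positivity)]; linarith
      have : p⁻¹ ≤ 1 := inv_le_one_of_one_le₀ hp
      rw [mul_assoc]
      exact mul_le_one₀ this (by positivity) (by assumption)
    calc |q - p| * (p⁻¹ * q⁻¹) * ‖Q‖ = |q - p| * (p⁻¹ * q⁻¹ * ‖Q‖) := by ring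
      _ ≤ |q - p| * 1 := by gcongr
      _ ≤ _ := by linarith
  have := mul_le_mul_of_nonneg_right a1 (norm_nonneg (P - Q))
  linarith

theorem hte_ode {F : Type*} [NormedAddCommGroup F] [InnerProductSpace ℝ F] [CompleteSpace F]
    {A : ℝ → F →L[ℝ] F} (hA : ContinuousOn A (Icc (0:ℝ) 1))
    (hS : ∀ t ∈ Icc (0:ℝ) 1, ∀ u₁ u₂ : F, ⟪A t u₁, u₂⟫ = -⟪u₁, A t u₂⟫) :
    ∃ U : ℝ → F →L[ℝ] F, U 0 = 1 ∧
      ∀ t ∈ Icc (0:ℝ) 1, HasDerivWithinAt U (-(A t * U t)) (Icc (0:ℝ) 1) t := by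
  obtain ⟨C, hC⟩ := isCompact_Icc.exists_bound_of_continuousOn hA
  have hC0 : 0 ≤ C := (norm_nonneg _).trans (hC 0 (by simp))
  lift C to NNReal using hC0
  let v : ℝ → (F →L[ℝ] F) → (F →L[ℝ] F) := fun t P => -(A t * ((max 1 ‖P‖)⁻¹ • P))
  have hpl : IsPicardLindelof v (tmin := 0) (tmax := 1) ⟨0, by simp⟩ 1 C 0 C (C * 2) := by
    constructor
    · intro t ht
      refine LipschitzOnWith.of_dist_le_mul fun P _ Q _ => ?_
      rw [dist_eq_norm, dist_eq_norm]
      have : v t P - v t Q = -(A t * ((max 1 ‖P‖)⁻¹ • P - (max 1 ‖Q‖)⁻¹ • Q)) := by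
        simp only [v, mul_sub]; abel
      rw [this, norm_neg]
      refine (norm_mul_le _ _).trans ?_
      push_cast
      rw [mul_assoc]
      gcongr
      · exact hC t ht
      · exact hte_clip P Q
    · intro P _
      exact (hA.mul continuousOn_const).neg
    · intro t ht P _
      simp only [v, norm_neg]
      refine (norm_mul_le _ _).trans ?_
      have : ‖(max 1 ‖P‖)⁻¹ • P‖ ≤ 1 := by
        rw [norm_smul, norm_inv, Real.norm_eq_abs, abs_of_nonneg (by positivity), inv_mul_le_iff₀ (by positivity)]
        simp
      calc ‖A t‖ * _ ≤ C * 1 := by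
            gcongr
            exact hC t ht
        _ = C := mul_one _
    · simp
  obtain ⟨U, hU0, hU⟩ := hpl.exists_eq_forall_mem_Icc_hasDerivWithinAt₀
  refine ⟨U, hU0, fun t ht => ?_⟩
  have hiso := hte_isom (P := U) (S := fun t => (max 1 ‖U t‖)⁻¹ • A t) (by
    intro t ht u₁ u₂
    simp [inner_smul_left, inner_smul_right, hS t ht u₁ u₂]) (by
    intro t ht
    have e : -(((max 1 ‖U t‖)⁻¹ • A t) * U t) = v t (U t) := by
      simp only [v, smul_mul_assoc, mul_smul_comm]
    rw [e]
    exact hU t ht)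
  have hn : ‖U t‖ ≤ 1 := by
    refine ContinuousLinearMap.opNorm_le_bound _ zero_le_one fun u => ?_
    rw [hiso u t ht]
    simp at hU0
    simp [hU0]
  have e : -(A t * U t) = v t (U t) := by
    simp only [v]
    rw [max_eq_left hn, inv_one, one_smul]
  rw [e]
  exact hU t ht

theorem hte_bilin {V E : Type*} [NormedAddCommGroup V] [InnerProductSpace ℝ V]
    [NormedAddCommGroup E] [NormedSpace ℝ E] (K : V →ₗ[ℝ] V →ₗ[ℝ] E) (hK : ∀ a, K a a = 0)
    (M : ℝ) (hM : ∀ v₁ v₂ : V, ‖v₁‖ = 1 → ‖v₂‖ = 1 → ‖K v₁ v₂‖ ≤ M) (a b : V) :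
    ‖K a b‖ ≤ M * Real.sqrt (‖a‖ ^ 2 * ‖b‖ ^ 2 - ⟪a, b⟫ ^ 2) := by
  by_cases ha : a = 0
  · subst ha; simp
  have ha' : ‖a‖ ≠ 0 := by simpa using ha
  obtain ⟨c, hc⟩ : ∃ c : ℝ, c = ⟪a, b⟫ / ‖a‖ ^ 2 := ⟨_, rfl⟩
  obtain ⟨d, hd⟩ : ∃ d : V, d = b - c • a := ⟨_, rfl⟩
  have h1 : K a b = K a d := by simp [hd, hK]
  have h2 : ‖a‖ ^ 2 * ‖b‖ ^ 2 - ⟪a, b⟫ ^ 2 = (‖a‖ * ‖d‖) ^ 2 := by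
    rw [mul_pow, hd, norm_sub_sq_real, inner_smul_right, norm_smul, real_inner_comm a b, mul_pow,
      Real.norm_eq_abs, sq_abs, hc]
    field_simp
    ring
  rw [h1, h2, Real.sqrt_sq (by positivity)]
  by_cases hd0 : d = 0
  · simp [hd0]
  have hd' : ‖d‖ ≠ 0 := by simpa using hd0
  have := hM (‖a‖⁻¹ • a) (‖d‖⁻¹ • d) (by simp [norm_smul, ha']) (by simp [norm_smul, hd'])
  simp only [map_smul, LinearMap.smul_apply, norm_smul, norm_inv, norm_norm] at this
  calc ‖K a d‖ = (‖a‖⁻¹ * (‖d‖⁻¹ * ‖K a d‖)) * (‖a‖ * ‖d‖) := by field_simp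
    _ ≤ M * (‖a‖ * ‖d‖) := by 
      refine mul_le_mul_of_nonneg_right ?_ (by positivity)
      linarith

theorem hte_mvt {E : Type*} [NormedAddCommGroup E] (f : ℝ → E) (m : ℝ)
    (hf : ∀ t ∈ Icc (0:ℝ) 1, ∀ ε > 0, ∃ δ > 0, ∀ t' ∈ Icc (0:ℝ) 1, |t' - t| < δ →
      ‖f t' - f t‖ ≤ (m + ε) * |t' - t|) : ‖f 1 - f 0‖ ≤ m := by
  have hcont : ContinuousOn f (Icc 0 1) := by
    intro t ht
    obtain ⟨δ, hδ, h⟩ := hf t ht 1 one_pos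
    rw [ContinuousWithinAt, tendsto_iff_norm_sub_tendsto_zero]
    refine squeeze_zero' (g := fun t' => (m + 1) * |t' - t|) (.of_forall fun _ => norm_nonneg _) ?_ ?_
    · have : ∀ᶠ t' in nhdsWithin t (Icc 0 1), |t' - t| < δ :=
        nhdsWithin_le_nhds (Metric.ball_mem_nhds t hδ)
      filter_upwards [this, self_mem_nhdsWithin] with t' h1 h2 using h t' h2 h1
    · refine Filter.Tendsto.mono_left ?_ nhdsWithin_le_nhds
      have : Continuous fun t' => (m + 1) * |t' - t| := by fun_prop
      simpa using this.tendsto t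
  refine le_of_forall_pos_le_add fun ε hε => ?_
  have := image_norm_le_of_liminf_right_slope_norm_lt_deriv_boundary (f := fun t => f t - f 0)
    (f' := fun _ => m) (a := 0) (b := 1) (B := fun t => (m + ε) * t) (B' := fun _ => m + ε)
    (hcont.sub continuousOn_const) ?_ (by simp) (by fun_prop) ?_ (fun _ _ _ => by linarith)
    (right_mem_Icc.2 zero_le_one)
  · simpa using this
  · intro t ht r hr
    refine Filter.Eventually.frequently ?_
    obtain ⟨δ, hδ, h⟩ := hf t ⟨ht.1, ht.2.le⟩ ((r - m) / 2) (by linarith)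
    have h1 : ∀ᶠ t' in nhdsWithin t (Ioi t), |t' - t| < δ :=
        nhdsWithin_le_nhds (Metric.ball_mem_nhds t hδ)
    have h2 : ∀ᶠ t' in nhdsWithin t (Ioi t), t' ∈ Ioo t 1 := Ioo_mem_nhdsGT ht.2
    filter_upwards [h1, h2] with t' h1 h2
    have h3 := h t' ⟨by linarith [ht.1, h2.1], h2.2.le⟩ h1
    have h4 : 0 < t' - t := by linarith [h2.1]
    rw [abs_of_pos h4] at h3
    simp only [slope_def_field, Function.comp]
    rw [div_lt_iff₀ h4]
    have h5 := norm_sub_norm_le (f t' - f 0) (f t - f 0)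
    rw [sub_sub_sub_cancel_right] at h5
    have : 0 < (r - m) / 2 * (t' - t) := by apply mul_pos <;> linarith
    linarith
  · intro t ht
    simpa using ((hasDerivAt_id t).const_mul (m + ε)).hasDerivWithinAt

theorem hte_core {F : Type*} [NormedAddCommGroup F] [InnerProductSpace ℝ F]
    [FiniteDimensional ℝ F] (A dA B dB : ℝ → ℝ → F →L[ℝ] F) (m : ℝ)
    (hA : ∀ s ∈ Icc (0:ℝ) 1, ∀ t ∈ Icc (0:ℝ) 1,
      HasDerivWithinAt (fun τ => A s τ) (dA s t) (Icc (0:ℝ) 1) t)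
    (hB : ∀ s ∈ Icc (0:ℝ) 1, ∀ t ∈ Icc (0:ℝ) 1,
      HasDerivWithinAt (fun σ => B σ t) (dB s t) (Icc (0:ℝ) 1) s)
    (hAc : ContinuousOn (fun p : ℝ × ℝ => A p.1 p.2) (Icc (0:ℝ) 1 ×ˢ Icc (0:ℝ) 1))
    (hdAc : ContinuousOn (fun p : ℝ × ℝ => dA p.1 p.2) (Icc (0:ℝ) 1 ×ˢ Icc (0:ℝ) 1))
    (hBc : ContinuousOn (fun p : ℝ × ℝ => B p.1 p.2) (Icc (0:ℝ) 1 ×ˢ Icc (0:ℝ) 1))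
    (hB0 : ∀ t ∈ Icc (0:ℝ) 1, B 0 t = 0)
    (hAs : ∀ s ∈ Icc (0:ℝ) 1, ∀ t ∈ Icc (0:ℝ) 1, ∀ u₁ u₂ : F, ⟪A s t u₁, u₂⟫ = -⟪u₁, A s t u₂⟫)
    (hK : ∀ s ∈ Icc (0:ℝ) 1, ∀ t ∈ Icc (0:ℝ) 1,
      ‖dA s t - dB s t - A s t * B s t + B s t * A s t‖ ≤ m * (2 * s))
    (P : ℝ → F →L[ℝ] F) (hPn : ∀ t ∈ Icc (0:ℝ) 1, ‖P t‖ ≤ 1)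
    (hP : ∀ t ∈ Icc (0:ℝ) 1, HasDerivWithinAt P (-(B 1 t * P t)) (Icc (0:ℝ) 1) t) :
    ∃ G : ℝ → ℝ → F →L[ℝ] F, (∀ t ∈ Icc (0:ℝ) 1, G 0 t = 1) ∧
      (∀ t ∈ Icc (0:ℝ) 1, ∀ s ∈ Icc (0:ℝ) 1,
        HasDerivWithinAt (fun σ => G σ t) (G s t * A s t) (Icc (0:ℝ) 1) s) ∧
      ‖G 1 1 * P 1 - G 1 0 * P 0‖ ≤ m := by
  have : CompleteSpace F := FiniteDimensional.complete ℝ F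
  have hex : ∀ t : ℝ, ∃ U : ℝ → F →L[ℝ] F, t ∈ Icc (0:ℝ) 1 → (U 0 = 1 ∧
      ∀ s ∈ Icc (0:ℝ) 1, HasDerivWithinAt U (-(A s t * U s)) (Icc (0:ℝ) 1) s) := by
    intro t
    by_cases ht : t ∈ Icc (0:ℝ) 1
    · obtain ⟨U, h1, h2⟩ := hte_ode (A := fun s => A s t)
        (hAc.comp (f := fun s : ℝ => (s, t)) (by fun_prop) (fun s hs => ⟨hs, ht⟩))
        (fun s hs => hAs s hs t ht)
      exact ⟨U, fun _ => ⟨h1, h2⟩⟩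
    · exact ⟨0, fun h => absurd h ht⟩
  choose U hU using hex
  have hUn : ∀ t ∈ Icc (0:ℝ) 1, ∀ s ∈ Icc (0:ℝ) 1, ‖U t s‖ ≤ 1 := by
    intro t ht s hs
    refine ContinuousLinearMap.opNorm_le_bound _ zero_le_one fun u => ?_
    rw [hte_isom (fun s hs => hAs s hs t ht) (hU t ht).2 u s hs, (hU t ht).1]
    simp
  have hG0 : ∀ t ∈ Icc (0:ℝ) 1, star (U t 0) = 1 := by
    intro t ht
    rw [(hU t ht).1, star_one]
  have hG : ∀ t ∈ Icc (0:ℝ) 1, ∀ s ∈ Icc (0:ℝ) 1,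
        HasDerivWithinAt (fun σ => star (U t σ)) (star (U t s) * A s t) (Icc (0:ℝ) 1) s := by
    intro t ht s hs
    have h1 := ((hU t ht).2 s hs).star
    have e : star (A s t) = - A s t := by
      rw [ContinuousLinearMap.star_eq_adjoint]
      symm
      rw [ContinuousLinearMap.eq_adjoint_iff]
      intro u v
      rw [neg_apply, inner_neg_left, hAs s hs t ht, neg_neg]
    have e2 : star (U t s) * A s t = star (-(A s t * U t s)) := by
      rw [star_neg, star_mul, e, mul_neg, neg_neg]
    rw [e2]
    exact h1
  have hGn : ∀ t ∈ Icc (0:ℝ) 1, ∀ s ∈ Icc (0:ℝ) 1, ‖star (U t s)‖ ≤ 1 := by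
    intro t ht s hs
    rw [ContinuousLinearMap.star_eq_adjoint, LinearIsometryEquiv.norm_map]
    exact hUn t ht s hs
  have hGU : ∀ t ∈ Icc (0:ℝ) 1, ∀ s ∈ Icc (0:ℝ) 1, star (U t s) * U t s = 1 := by
    intro t ht s hs
    have := hte_const (f := fun s => star (U t s) * U t s) (fun s hs => by
      have := (hG t ht s hs).mul ((hU t ht).2 s hs)
      refine this.congr_deriv ?_
      noncomm_ring) s hs
    simp only [(hU t ht).1, mul_one, star_one] at this
    exact this
  have hUG : ∀ t ∈ Icc (0:ℝ) 1, ∀ s ∈ Icc (0:ℝ) 1, U t s * star (U t s) = 1 := by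
    intro t ht s hs
    have h1 : ((star (U t s) : F →L[ℝ] F) : F →ₗ[ℝ] F) * (U t s : F →ₗ[ℝ] F) = 1 := by
      rw [← ContinuousLinearMap.toLinearMap_mul, hGU t ht s hs]
      rfl
    have h2 := mul_eq_one_comm.1 h1
    rw [← ContinuousLinearMap.toLinearMap_mul] at h2
    exact ContinuousLinearMap.coe_injective h2
  refine ⟨fun s t => star (U t s), hG0, hG, ?_⟩
  refine hte_mvt (fun t => star (U t 1) * P t) m ?_
  intro t ht ε hε
  have hone : (1:ℝ) ∈ Icc (0:ℝ) 1 := by simp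
  have hcpt : IsCompact (Icc (0:ℝ) 1 ×ˢ Icc (0:ℝ) 1) := isCompact_Icc.prod isCompact_Icc
  obtain ⟨C, hC⟩ := hcpt.exists_bound_of_continuousOn hBc
  have hC0 : 0 ≤ C := (norm_nonneg _).trans (hC (0, 0) (by simp))
  obtain ⟨η, hη, hηC⟩ : ∃ η > 0, η * (2 + C) ≤ ε :=
    ⟨ε / (2 + C), by positivity, by rw [div_mul_cancel₀ _ (by positivity)]⟩
  obtain ⟨δ₁, hδ₁, h₁⟩ := Metric.uniformContinuousOn_iff.1
    (hcpt.uniformContinuousOn_of_continuous hdAc) η hη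
  obtain ⟨δ₂, hδ₂, h₂⟩ := Metric.uniformContinuousOn_iff.1
    (hcpt.uniformContinuousOn_of_continuous hAc) η hη
  obtain ⟨δ₃, hδ₃, h₃⟩ : ∃ δ > 0, ∀ t' ∈ Icc (0:ℝ) 1, |t' - t| < δ →
      ‖P t' - P t - (t' - t) • (-(B 1 t * P t))‖ ≤ η * |t' - t| := by
    have := (hasDerivWithinAt_iff_isLittleO.1 (hP t ht)).def hη
    rw [eventually_nhdsWithin_iff, Metric.eventually_nhds_iff] at this
    obtain ⟨δ, hδ, h⟩ := this
    exact ⟨δ, hδ, fun t' ht' hd => h hd ht'⟩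
  refine ⟨min δ₁ (min δ₂ δ₃), by positivity, fun t' ht' hd => ?_⟩
  simp only [lt_min_iff] at hd
  obtain ⟨hd1, hd2, hd3⟩ := hd
  obtain ⟨h, hh⟩ : ∃ h, h = t' - t := ⟨_, rfl⟩
  have hA1 : ∀ s ∈ Icc (0:ℝ) 1, ‖A s t' - A s t - h • dA s t‖ ≤ η * |h| := by
    intro s hs
    have := Convex.norm_image_sub_le_of_norm_hasDerivWithin_le
      (f := fun τ => A s τ - τ • dA s t) (f' := fun τ => dA s τ - dA s t) (C := η)
      (s := Icc (0:ℝ) 1 ∩ Metric.ball t δ₁) (x := t) (y := t') ?_ ?_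
      ((convex_Icc _ _).inter (convex_ball _ _)) ⟨ht, Metric.mem_ball_self hδ₁⟩ ⟨ht', hd1⟩
    · rw [Real.norm_eq_abs, ← hh] at this
      have e : A s t' - A s t - h • dA s t = A s t' - t' • dA s t - (A s t - t • dA s t) := by
        rw [hh]
        module
      rw [e]
      exact this
    · intro τ hτ
      have h1 := ((hasDerivWithinAt_id τ (Icc (0:ℝ) 1)).smul_const (dA s t))
      rw [one_smul] at h1
      exact ((hA s hs τ hτ.1).sub h1).mono inter_subset_left
    · intro τ hτ
      have := h₁ (s, τ) ⟨hs, hτ.1⟩ (s, t) ⟨hs, ht⟩ (by simpa [Prod.dist_eq, hδ₁] using hτ.2)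
      rw [dist_eq_norm] at this
      exact this.le
  have hA2 : ∀ s ∈ Icc (0:ℝ) 1, ‖A s t' - A s t‖ ≤ η := by
    intro s hs
    have := h₂ (s, t') ⟨hs, ht'⟩ (s, t) ⟨hs, ht⟩ (by
      simpa [Prod.dist_eq, hδ₂, Real.dist_eq] using hd2)
    rw [dist_eq_norm] at this
    exact this.le
  let X : ℝ → F →L[ℝ] F := fun s => A s t' * (1 - h • B s t) - h • dB s t - (1 - h • B s t) * A s t
  have hX : ∀ s ∈ Icc (0:ℝ) 1, ‖X s‖ ≤ |h| * (m * (2 * s) + η * (1 + C)) := by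
    intro s hs
    have e : X s = (A s t' - A s t - h • dA s t)
        + h • (dA s t - dB s t - A s t * B s t + B s t * A s t)
        - h • ((A s t' - A s t) * B s t) := by
      simp only [X, mul_sub, sub_mul, mul_one, one_mul, mul_smul_comm, smul_mul_assoc]
      module
    rw [e]
    have b1 := hA1 s hs
    have b2 : ‖h • (dA s t - dB s t - A s t * B s t + B s t * A s t)‖ ≤ |h| * (m * (2 * s)) := by
      rw [norm_smul, Real.norm_eq_abs]
      exact mul_le_mul_of_nonneg_left (hK s hs t ht) (abs_nonneg _)
    have b3 : ‖h • ((A s t' - A s t) * B s t)‖ ≤ |h| * (η * C) := by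
      rw [norm_smul, Real.norm_eq_abs]
      refine mul_le_mul_of_nonneg_left ((norm_mul_le _ _).trans ?_) (abs_nonneg _)
      exact mul_le_mul (hA2 s hs) (hC (s, t) ⟨hs, ht⟩) (norm_nonneg _) hη.le
    refine (norm_sub_le _ _).trans ?_
    refine (add_le_add_left (norm_add_le _ _) _).trans ?_
    linarith
  let φ : ℝ → F →L[ℝ] F := fun s => star (U t' s) * (1 - h • B s t) * U t s
  have hφ : ∀ s ∈ Icc (0:ℝ) 1,
      HasDerivWithinAt φ (star (U t' s) * X s * U t s) (Icc (0:ℝ) 1) s := by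
    intro s hs
    have h1 := ((hG t' ht' s hs).mul (((hB s hs t ht).const_smul h).const_sub 1)).mul
      ((hU t ht).2 s hs)
    refine h1.congr_deriv ?_
    simp only [X]
    generalize h • dB s t = b'
    simp only [Pi.smul_apply, Pi.mul_apply]
    generalize h • B s t = b
    noncomm_ring
  have hφ0 : φ 0 = 1 := by
    simp [φ, hG0 t' ht', hB0 t ht, (hU t ht).1]
  have hφ1 : ‖φ 1 - 1‖ ≤ |h| * (m + η * (1 + C)) := by
    have := image_norm_le_of_norm_deriv_right_le_deriv_boundary' (f := fun s => φ s - 1)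
      (f' := fun s => star (U t' s) * X s * U t s) (a := 0) (b := 1)
      (B := fun s => |h| * (m * s ^ 2 + η * (1 + C) * s))
      (B' := fun s => |h| * (m * (2 * s) + η * (1 + C)))
      (fun s hs => ((hφ s hs).sub_const 1).continuousWithinAt) ?_ (by simp [hφ0]) (by fun_prop)
      ?_ ?_ hone
    · simpa using this
    · intro s hs
      exact ((hφ s ⟨hs.1, hs.2.le⟩).sub_const 1).mono_of_mem_nhdsWithin (Icc_mem_nhdsGE_of_mem hs)
    · intro s hs
      have h1 := ((((hasDerivAt_pow 2 s).const_mul m).add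
        ((hasDerivAt_id s).const_mul (η * (1 + C)))).const_mul |h|).hasDerivWithinAt (s := Ici s)
      refine h1.congr_deriv ?_
      simp
    · intro s hs
      have hs' : s ∈ Icc (0:ℝ) 1 := ⟨hs.1, hs.2.le⟩
      have c1 : ‖star (U t' s) * X s‖ ≤ ‖X s‖ :=
        (norm_mul_le _ _).trans (mul_le_of_le_one_left (norm_nonneg _) (hGn t' ht' s hs'))
      have c2 : ‖star (U t' s) * X s * U t s‖ ≤ ‖star (U t' s) * X s‖ :=
        (norm_mul_le _ _).trans (mul_le_of_le_one_right (norm_nonneg _) (hUn t ht s hs'))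
      exact c2.trans (c1.trans (hX s hs'))
  have e : star (U t' 1) * P t' - star (U t 1) * P t
      = star (U t' 1) * (P t' - P t - (t' - t) • (-(B 1 t * P t)))
        + (φ 1 - 1) * (star (U t 1) * P t) := by
    have : (φ 1 - 1) * (star (U t 1) * P t)
        = star (U t' 1) * (1 - h • B 1 t) * (U t 1 * star (U t 1)) * P t - star (U t 1) * P t := by
      simp only [φ]
      noncomm_ring
    rw [this, hUG t ht 1 hone, ← hh]
    simp only [mul_sub, sub_mul, mul_one, smul_neg, mul_neg, mul_smul_comm, smul_mul_assoc, mul_assoc]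
    abel
  show ‖star (U t' 1) * P t' - star (U t 1) * P t‖ ≤ _
  rw [e]
  refine (norm_add_le _ _).trans ?_
  have d1 : ‖star (U t' 1) * (P t' - P t - (t' - t) • (-(B 1 t * P t)))‖ ≤ η * |t' - t| :=
    (norm_mul_le _ _).trans
      ((mul_le_of_le_one_left (norm_nonneg _) (hGn t' ht' 1 hone)).trans (h₃ t' ht' hd3))
  have d2 : ‖(φ 1 - 1) * (star (U t 1) * P t)‖ ≤ |h| * (m + η * (1 + C)) := by
    refine (norm_mul_le _ _).trans ((mul_le_of_le_one_right (norm_nonneg _) ?_).trans hφ1)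
    exact (norm_mul_le _ _).trans (mul_le_one₀ (hGn t ht 1 hone) (norm_nonneg _) (hPn t ht))
  rw [← hh] at d1 ⊢
  have d3 : η * (2 + C) * |h| ≤ ε * |h| := mul_le_mul_of_nonneg_right hηC (abs_nonneg _)
  linarith

/-- Holonomy estimate along a triangle:
`‖id − R^Γ(x,y) ∘ R^Γ(y,z) ∘ R^Γ(z,x)‖ ≤ ‖K_Γ‖_{L∞(Δ)} · |Δ|`, stated for every upper
bound `M` of `‖K_Γ(w)[v₁,v₂]‖` over `w ∈ Δ` and unit vectors `v₁, v₂`. -/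
theorem holonomy_triangle_estimate
    {F : Type*} [NormedAddCommGroup F] [InnerProductSpace ℝ F] [FiniteDimensional ℝ F]
    {N : ℕ}
    (Ω : Set (EuclideanSpace ℝ (Fin N))) (hΩ : IsOpen Ω)
    -- Γ of class C¹ on Ω with derivative DΓ, with skew-adjoint values
    (Γ : EuclideanSpace ℝ (Fin N) → EuclideanSpace ℝ (Fin N) →L[ℝ] F →L[ℝ] F)
    (DΓ : EuclideanSpace ℝ (Fin N) →
      EuclideanSpace ℝ (Fin N) →L[ℝ] EuclideanSpace ℝ (Fin N) →L[ℝ] F →L[ℝ] F)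
    (hΓ : ∀ w ∈ Ω, HasFDerivAt Γ (DΓ w) w)
    (hDΓcont : ContinuousOn DΓ Ω)
    (hskew : ∀ w ∈ Ω, ∀ (v : EuclideanSpace ℝ (Fin N)) (u₁ u₂ : F),
      ⟪(Γ w v) u₁, u₂⟫ = -⟪u₁, (Γ w v) u₂⟫)
    -- the closed triangle with vertices x, y, z is contained in Ω
    (x y z : EuclideanSpace ℝ (Fin N))
    (htri : convexHull ℝ ({x, y, z} : Set (EuclideanSpace ℝ (Fin N))) ⊆ Ω)
    -- the three parallel transports along the sides of the triangle:
    -- R^Γ(x,y) = Pxy 0, R^Γ(y,z) = Pyz 0, R^Γ(z,x) = Pzx 0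
    (Pxy Pyz Pzx : ℝ → F →L[ℝ] F)
    (hPxy : ∀ t ∈ Icc (0:ℝ) 1, HasDerivWithinAt Pxy
      (-((Γ ((1 - t) • x + t • y)) (y - x)).comp (Pxy t)) (Icc (0:ℝ) 1) t)
    (hPxy1 : Pxy 1 = ContinuousLinearMap.id ℝ F)
    (hPyz : ∀ t ∈ Icc (0:ℝ) 1, HasDerivWithinAt Pyz
      (-((Γ ((1 - t) • y + t • z)) (z - y)).comp (Pyz t)) (Icc (0:ℝ) 1) t)
    (hPyz1 : Pyz 1 = ContinuousLinearMap.id ℝ F)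
    (hPzx : ∀ t ∈ Icc (0:ℝ) 1, HasDerivWithinAt Pzx
      (-((Γ ((1 - t) • z + t • x)) (x - z)).comp (Pzx t)) (Icc (0:ℝ) 1) t)
    (hPzx1 : Pzx 1 = ContinuousLinearMap.id ℝ F) :
    ∀ M : ℝ,
      (∀ w ∈ convexHull ℝ ({x, y, z} : Set (EuclideanSpace ℝ (Fin N))),
        ∀ v₁ v₂ : EuclideanSpace ℝ (Fin N), ‖v₁‖ = 1 → ‖v₂‖ = 1 →
          ‖((DΓ w) v₁) v₂ - ((DΓ w) v₂) v₁
            + ((Γ w) v₁).comp ((Γ w) v₂) - ((Γ w) v₂).comp ((Γ w) v₁)‖ ≤ M) →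
      ‖ContinuousLinearMap.id ℝ F - (Pxy 0).comp ((Pyz 0).comp (Pzx 0))‖
        ≤ M * ((1 / 2) * Real.sqrt (‖y - x‖ ^ 2 * ‖z - x‖ ^ 2 - ⟪y - x, z - x⟫ ^ 2)) := by
  intro M hM
  obtain ⟨e, he⟩ : ∃ e : ℝ → EuclideanSpace ℝ (Fin N), e = fun t => (y - x) + t • (z - y) :=
    ⟨_, rfl⟩
  obtain ⟨q, hq⟩ : ∃ q : ℝ → ℝ → EuclideanSpace ℝ (Fin N), q = fun s t => x + s • e t := ⟨_, rfl⟩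
  have hqmem : ∀ s ∈ Icc (0:ℝ) 1, ∀ t ∈ Icc (0:ℝ) 1,
      q s t ∈ convexHull ℝ ({x, y, z} : Set (EuclideanSpace ℝ (Fin N))) := by
    intro s hs t ht
    have hx : x ∈ convexHull ℝ ({x, y, z} : Set (EuclideanSpace ℝ (Fin N))) :=
      subset_convexHull ℝ _ (by simp)
    have hy : y ∈ convexHull ℝ ({x, y, z} : Set (EuclideanSpace ℝ (Fin N))) :=
      subset_convexHull ℝ _ (by simp)
    have hz : z ∈ convexHull ℝ ({x, y, z} : Set (EuclideanSpace ℝ (Fin N))) :=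
      subset_convexHull ℝ _ (by simp)
    have hc := convex_convexHull ℝ ({x, y, z} : Set (EuclideanSpace ℝ (Fin N)))
    have h1 := hc hy hz (sub_nonneg.2 ht.2) ht.1 (by ring : (1 - t) + t = 1)
    have h2 := hc hx h1 (sub_nonneg.2 hs.2) hs.1 (by ring : (1 - s) + s = 1)
    have e1 : q s t = (1 - s) • x + s • ((1 - t) • y + t • z) := by
      rw [hq, he]
      module
    rw [e1]
    exact h2
  have hqΩ : ∀ s ∈ Icc (0:ℝ) 1, ∀ t ∈ Icc (0:ℝ) 1, q s t ∈ Ω :=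
    fun s hs t ht => htri (hqmem s hs t ht)
  have h0 : (0:ℝ) ∈ Icc (0:ℝ) 1 := by simp
  have h1 : (1:ℝ) ∈ Icc (0:ℝ) 1 := by simp
  have hed : ∀ t, HasDerivAt e (z - y) t := by
    intro t
    have := ((hasDerivAt_id t).smul_const (z - y)).const_add (y - x)
    rw [one_smul] at this
    rw [he]
    exact this
  have hqt : ∀ s t, HasDerivAt (fun τ => q s τ) (s • (z - y)) t := by
    intro s t
    have := ((hed t).const_smul s).const_add x
    rw [hq]
    exact this
  have hqs : ∀ s t, HasDerivAt (fun σ => q σ t) (e t) s := by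
    intro s t
    have := ((hasDerivAt_id s).smul_const (e t)).const_add x
    rw [one_smul] at this
    rw [hq]
    exact this
  have hec : Continuous fun p : ℝ × ℝ => e p.2 := by
    rw [he]
    fun_prop
  have hqc : Continuous fun p : ℝ × ℝ => q p.1 p.2 := by
    rw [hq]
    exact continuous_const.add (continuous_fst.smul hec)
  have hmaps : MapsTo (fun p : ℝ × ℝ => q p.1 p.2) (Icc (0:ℝ) 1 ×ˢ Icc (0:ℝ) 1) Ω :=
    fun p hp => hqΩ p.1 hp.1 p.2 hp.2
  have hΓc : ContinuousOn (fun p : ℝ × ℝ => Γ (q p.1 p.2)) (Icc (0:ℝ) 1 ×ˢ Icc (0:ℝ) 1) :=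
    ContinuousOn.comp (g := Γ) (fun w hw => (hΓ w hw).continuousAt.continuousWithinAt)
      hqc.continuousOn hmaps
  have hDΓc : ContinuousOn (fun p : ℝ × ℝ => DΓ (q p.1 p.2)) (Icc (0:ℝ) 1 ×ˢ Icc (0:ℝ) 1) :=
    ContinuousOn.comp (g := DΓ) hDΓcont hqc.continuousOn hmaps
  have hwc : Continuous fun p : ℝ × ℝ => p.1 • (z - y) := by fun_prop
  have hisoN : ∀ (P S : ℝ → F →L[ℝ] F),
      (∀ t ∈ Icc (0:ℝ) 1, ∀ u₁ u₂ : F, ⟪S t u₁, u₂⟫ = -⟪u₁, S t u₂⟫) →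
      (∀ t ∈ Icc (0:ℝ) 1, HasDerivWithinAt P (-(S t * P t)) (Icc (0:ℝ) 1) t) →
      P 1 = 1 → ∀ t ∈ Icc (0:ℝ) 1, ‖P t‖ ≤ 1 := by
    intro P S hS hP hP1 t ht
    refine ContinuousLinearMap.opNorm_le_bound _ zero_le_one fun u => ?_
    rw [hte_isom hS hP u t ht, ← hte_isom hS hP u 1 h1, hP1]
    simp
  -- the three sides in terms of `q`
  have hyz : ∀ t, (1 - t) • y + t • z = q 1 t := by
    intro t
    rw [hq, he]
    module
  have hxy : ∀ t, (1 - t) • x + t • y = q t 0 := by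
    intro t
    rw [hq, he]
    module
  have hzx : ∀ t, (1 - t) • z + t • x = q (1 - t) 1 := by
    intro t
    rw [hq, he]
    module
  have he0 : e 0 = y - x := by
    rw [he]
    module
  have he1 : e 1 = z - x := by
    rw [he]
    module
  have hPyz' : ∀ t ∈ Icc (0:ℝ) 1,
      HasDerivWithinAt Pyz (-(Γ (q 1 t) ((1:ℝ) • (z - y)) * Pyz t)) (Icc (0:ℝ) 1) t := by
    intro t ht
    have := hPyz t ht
    rw [hyz] at this
    rw [one_smul]
    exact this
  have hPxy' : ∀ t ∈ Icc (0:ℝ) 1,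
      HasDerivWithinAt Pxy (-(Γ (q t 0) (e 0) * Pxy t)) (Icc (0:ℝ) 1) t := by
    intro t ht
    have := hPxy t ht
    rw [hxy, ← he0] at this
    exact this
  have hPzx' : ∀ t ∈ Icc (0:ℝ) 1,
      HasDerivWithinAt Pzx (-(-(Γ (q (1 - t) 1) (e 1)) * Pzx t)) (Icc (0:ℝ) 1) t := by
    intro t ht
    have := hPzx t ht
    rw [hzx, ← neg_sub z x, ← he1, map_neg] at this
    exact this
  have hPyzn := hisoN Pyz (fun t => Γ (q 1 t) ((1:ℝ) • (z - y)))
    (fun t ht => hskew _ (hqΩ 1 h1 t ht) _) hPyz' hPyz1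
  have hrev : ∀ t ∈ Icc (0:ℝ) 1, 1 - t ∈ Icc (0:ℝ) 1 :=
    fun t ht => ⟨by linarith [ht.2], by linarith [ht.1]⟩
  have hPzxn := hisoN Pzx (fun t => -(Γ (q (1 - t) 1) (e 1)))
    (fun t ht u₁ u₂ => by
      rw [neg_apply, neg_apply, inner_neg_left, inner_neg_right,
        hskew _ (hqΩ (1 - t) (hrev t ht) 1 h1) (e 1) u₁ u₂]) hPzx' hPzx1
  obtain ⟨G, hG0, hG, hGm⟩ := hte_core (F := F)
    (fun s t => Γ (q s t) (e t))
    (fun s t => DΓ (q s t) (s • (z - y)) (e t) + Γ (q s t) (z - y))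
    (fun s t => Γ (q s t) (s • (z - y)))
    (fun s t => DΓ (q s t) (e t) (s • (z - y)) + Γ (q s t) (z - y))
    (M * ((1 / 2) * Real.sqrt (‖y - x‖ ^ 2 * ‖z - x‖ ^ 2 - ⟪y - x, z - x⟫ ^ 2)))
    (by
      intro s hs t ht
      exact (((hΓ _ (hqΩ s hs t ht)).comp_hasDerivAt t (hqt s t)).clm_apply
        (hed t)).hasDerivWithinAt)
    (by
      intro s hs t ht
      have hd : HasDerivAt (fun σ : ℝ => σ • (z - y)) (z - y) s := by
        have := (hasDerivAt_id s).smul_const (z - y)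
        rw [one_smul] at this
        exact this
      exact (((hΓ _ (hqΩ s hs t ht)).comp_hasDerivAt s (hqs s t)).clm_apply hd).hasDerivWithinAt)
    (hΓc.clm_apply hec.continuousOn)
    (((hDΓc.clm_apply hwc.continuousOn).clm_apply hec.continuousOn).add
      (hΓc.clm_apply continuousOn_const))
    (hΓc.clm_apply hwc.continuousOn)
    (by intro t _; simp)
    (fun s hs t ht => hskew _ (hqΩ s hs t ht) _)
    (by
      intro s hs t ht
      let K : EuclideanSpace ℝ (Fin N) →ₗ[ℝ] EuclideanSpace ℝ (Fin N) →ₗ[ℝ] (F →L[ℝ] F) :=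
        LinearMap.mk₂ ℝ (fun v₁ v₂ => DΓ (q s t) v₁ v₂ - DΓ (q s t) v₂ v₁
            + Γ (q s t) v₁ * Γ (q s t) v₂ - Γ (q s t) v₂ * Γ (q s t) v₁)
          (by
            intro a b c
            simp only [map_add, add_apply, add_mul, mul_add]
            abel)
          (by
            intro r a b
            simp only [map_smul, smul_apply, smul_mul_assoc, mul_smul_comm]
            module)
          (by
            intro a b c
            simp only [map_add, add_apply, add_mul, mul_add]
            abel)
          (by
            intro r a b
            simp only [map_smul, smul_apply, smul_mul_assoc, mul_smul_comm]
            module)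
      have hKK := hte_bilin K (by intro a; simp [K]) M
        (fun v₁ v₂ hv₁ hv₂ => hM (q s t) (hqmem s hs t ht) v₁ v₂ hv₁ hv₂) (s • (z - y)) (e t)
      have e1 : K (s • (z - y)) (e t) = DΓ (q s t) (s • (z - y)) (e t) + Γ (q s t) (z - y)
          - (DΓ (q s t) (e t) (s • (z - y)) + Γ (q s t) (z - y))
          - Γ (q s t) (e t) * Γ (q s t) (s • (z - y))
          + Γ (q s t) (s • (z - y)) * Γ (q s t) (e t) := by
        simp only [K, LinearMap.mk₂_apply]
        abel
      rw [e1] at hKK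
      refine hKK.trans (le_of_eq ?_)
      have e2 : ‖s • (z - y)‖ ^ 2 * ‖e t‖ ^ 2 - ⟪s • (z - y), e t⟫ ^ 2
          = s ^ 2 * (‖y - x‖ ^ 2 * ‖z - x‖ ^ 2 - ⟪y - x, z - x⟫ ^ 2) := by
        have a1 : z - y = (z - x) - (y - x) := by abel
        rw [he]
        simp only [a1]
        generalize z - x = b
        generalize y - x = a
        simp only [← real_inner_self_eq_norm_sq, inner_smul_left, inner_smul_right, inner_add_left,
          inner_add_right, inner_sub_left, inner_sub_right, real_inner_comm a b,
          RCLike.conj_to_real]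
        ring
      rw [e2, Real.sqrt_mul (sq_nonneg s), Real.sqrt_sq hs.1]
      ring)
    Pyz hPyzn hPyz'
  have hx1 : G 1 0 = Pxy 0 := by
    have := hte_const (f := fun s => G s 0 * Pxy s) (fun s hs => by
      refine ((hG 0 h0 s hs).mul (hPxy' s hs)).congr_deriv ?_
      noncomm_ring) 1 h1
    simp only [hG0 0 h0, one_mul] at this
    rw [← this, hPxy1]
    rfl
  have hz1 : G 1 1 * Pzx 0 = 1 := by
    have := hte_const (f := fun s => G (1 - s) 1 * Pzx s) (fun s hs => by
      have hr : HasDerivWithinAt (fun σ : ℝ => 1 - σ) (-1) (Icc (0:ℝ) 1) s :=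
        (hasDerivWithinAt_id s _).const_sub 1
      have hg := (hG 1 h1 (1 - s) (hrev s hs)).scomp s hr hrev
      refine (hg.mul (hPzx' s hs)).congr_deriv ?_
      simp only [Function.comp, neg_smul, one_smul]
      noncomm_ring) 1 h1
    simp only [sub_self, sub_zero, hG0 1 h1, one_mul] at this
    rw [← this, hPzx1]
    rfl
  have hfin : ContinuousLinearMap.id ℝ F - (Pxy 0).comp ((Pyz 0).comp (Pzx 0))
      = (G 1 1 * Pyz 1 - G 1 0 * Pyz 0) * Pzx 0 := by
    have e1 : Pyz 1 = 1 := hPyz1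
    rw [hx1, e1, mul_one, sub_mul, hz1, mul_assoc]
    rfl
  rw [hfin]
  exact (norm_mul_le _ _).trans
    ((mul_le_of_le_one_right (norm_nonneg _) (hPzxn 0 h0)).trans hGm)
end

section
/- Let F be a finite-dimensional real inner product space, n ≥ 1, and let Γ ∈ C¹ be a connection form on the closed half-space ℝⁿ × [0,∞) ⊆ ℝ^{n+1} with values in L(ℝ^{n+1}, o(F)). Let U : ℝⁿ × [0,∞) → F be C¹. Then for every x, y, z in the closed half-space: ‖U(x) − R^Γ(x,y)U(y)‖ ≤ ‖U(x) − R^Γ(x,z)U(z)‖ + ‖U(y) − R^Γ(y,z)U(z)‖ + ‖U(z)‖ · min{2, ‖K_Γ‖_∞ · |Δ_{x,y,z}|}, where |Δ_{x,y,z}| = (1/2)·√(‖y−x‖²‖z−x‖² − ⟨y−x, z−x⟩²) and ‖K_Γ‖_∞ is the supremum over points of the half-space and unit vectors v, w of the operator norm ‖K_Γ(·)[v,w]‖. -/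
set_option synthInstance.maxHeartbeats 1000000
set_option maxHeartbeats 1000000

open Set
open scoped RealInnerProductSpace

/-- The closed upper half-space `ℝⁿ × [0,∞) ⊆ ℝ^{n+1}`. -/
def closedHalfSpace (n : ℕ) : Set (EuclideanSpace ℝ (Fin (n + 1))) :=
  {z | 0 ≤ z (Fin.last n)}

theorem energy_est {F : Type*} [NormedAddCommGroup F] [InnerProductSpace ℝ F]
    (A : ℝ → F →L[ℝ] F) (f g : ℝ → F) (a b : ℝ) 
    (hf : ∀ s ∈ Icc (0:ℝ) 1, HasDerivWithinAt f (-(A s (f s)) + g s) (Icc (0:ℝ) 1) s)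
    (hA : ∀ s ∈ Icc (0:ℝ) 1, ∀ v : F, ⟪A s v, v⟫ = 0)
    (hg : ∀ s ∈ Icc (0:ℝ) 1, ‖g s‖ ≤ a * s + b) (s : ℝ) (hs : s ∈ Icc (0:ℝ) 1) :
    ‖f s‖ ≤ ‖f 1‖ + a * (1 - s ^ 2) / 2 + b * (1 - s) := by
  refine le_of_forall_pos_le_add fun η hη => ?_
  have hpos : ∀ t, 0 < ‖f t‖ ^ 2 + η ^ 2 := fun t => by positivity
  have hd : ∀ t ∈ Icc (0:ℝ) 1, HasDerivWithinAt
      (fun t => Real.sqrt (‖f t‖ ^ 2 + η ^ 2) + (a * t ^ 2 / 2 + b * t))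
      ((2 * ⟪f t, -(A t (f t)) + g t⟫) / (2 * Real.sqrt (‖f t‖ ^ 2 + η ^ 2)) + (a * t + b))
      (Icc (0:ℝ) 1) t := by
    intro t ht
    have h1 := (((hf t ht).norm_sq).add_const (η ^ 2)).sqrt (hpos t).ne'
    have h2 : HasDerivAt (fun t : ℝ => a * t ^ 2 / 2 + b * t) (a * t + b) t := by
      have := (((hasDerivAt_id t).pow 2).const_mul a).div_const 2
      have := this.add ((hasDerivAt_id t).const_mul b)
      refine (this.congr_deriv ?_).congr_of_eventuallyEq (Filter.Eventually.of_forall fun _ => ?_)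
      · simp; ring
      · simp
    exact h1.add h2.hasDerivWithinAt
  have hmono := monotoneOn_of_hasDerivWithinAt_nonneg (convex_Icc (0:ℝ) 1)
    (fun t ht => (hd t ht).continuousWithinAt)
    (fun t ht => (hd t (interior_subset ht)).mono interior_subset) (by
      intro t ht
      have ht := interior_subset ht
      have hsq : 0 < Real.sqrt (‖f t‖ ^ 2 + η ^ 2) := Real.sqrt_pos.2 (hpos t)
      have h1 : ⟪f t, -(A t (f t)) + g t⟫ = ⟪f t, g t⟫ := by
        rw [inner_add_right, inner_neg_right, real_inner_comm, hA t ht]; simp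
      have h2 : |⟪f t, g t⟫| ≤ ‖f t‖ * ‖g t‖ := abs_real_inner_le_norm _ _
      have h3 : ‖f t‖ ≤ Real.sqrt (‖f t‖ ^ 2 + η ^ 2) :=
        Real.le_sqrt_of_sq_le (by nlinarith [sq_nonneg η])
      have h4 := hg t ht
      rw [h1, mul_div_mul_left _ _ (two_ne_zero)]
      have h5 : -(a * t + b) ≤ ⟪f t, g t⟫ / Real.sqrt (‖f t‖ ^ 2 + η ^ 2) := by
        rw [le_div_iff₀ hsq]
        have := neg_abs_le ⟪f t, g t⟫
        nlinarith [norm_nonneg (g t), norm_nonneg (f t)]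
      linarith)
  have h := hmono hs (right_mem_Icc.2 zero_le_one) hs.2
  have h3 : ‖f s‖ ≤ Real.sqrt (‖f s‖ ^ 2 + η ^ 2) :=
    Real.le_sqrt_of_sq_le (by nlinarith [sq_nonneg η])
  have h4 : Real.sqrt (‖f 1‖ ^ 2 + η ^ 2) ≤ ‖f 1‖ + η := by
    rw [Real.sqrt_le_left (by positivity)]
    nlinarith [norm_nonneg (f 1)]
  simp only at h
  nlinarith

theorem ode_exists {F : Type*} [NormedAddCommGroup F] [InnerProductSpace ℝ F]
    [FiniteDimensional ℝ F]
    (A : ℝ → F →L[ℝ] F) (w : F) (hAc : ContinuousOn A (Icc (0:ℝ) 1))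
    (hA : ∀ s ∈ Icc (0:ℝ) 1, ∀ v : F, ⟪A s v, v⟫ = 0) :
    ∃ f : ℝ → F, f 1 = w ∧
      ∀ s ∈ Icc (0:ℝ) 1, HasDerivWithinAt f (-(A s (f s))) (Icc (0:ℝ) 1) s := by
  let χ : ContDiffBump (0 : F) := ⟨‖w‖ + 1, ‖w‖ + 2, by positivity, by linarith⟩
  have hcs : HasCompactSupport (fun x : F => χ x • x) := χ.hasCompactSupport.smul_right
  have hsm : ContDiff ℝ 1 (fun x : F => χ x • x) := (χ.contDiff).smul contDiff_id
  obtain ⟨C, hC⟩ := ContDiff.lipschitzWith_of_hasCompactSupport hcs hsm one_ne_zero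
  obtain ⟨D, hD⟩ := hcs.exists_bound_of_continuous hsm.continuous
  obtain ⟨E, hE⟩ := (isCompact_Icc (a := (0:ℝ)) (b := 1)).exists_bound_of_continuousOn hAc
  have hD0 : 0 ≤ D := (norm_nonneg _).trans (hD 0)
  have hE0 : 0 ≤ E := (norm_nonneg _).trans (hE 0 (by simp))
  have hPL : IsPicardLindelof (fun t x => -(A t (χ x • x))) (tmin := 0) (tmax := 1)
      (⟨1, by simp⟩ : Icc (0:ℝ) 1) w (E * D).toNNReal 0 (E * D).toNNReal (E.toNNReal * C) := by
    refine ⟨?_, ?_, ?_, ?_⟩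
    · intro t ht
      refine LipschitzWith.lipschitzOnWith ?_
      refine LipschitzWith.of_dist_le_mul fun x y => ?_
      rw [dist_neg_neg, dist_eq_norm, ← map_sub]
      refine ((A t).le_of_opNorm_le (hE t ht) _).trans ?_
      have := hC.dist_le_mul x y
      rw [dist_eq_norm] at this
      push_cast
      rw [Real.coe_toNNReal _ hE0, mul_assoc]
      gcongr
    · intro x _
      exact (hAc.clm_apply continuousOn_const).neg
    · intro t ht x _
      rw [norm_neg, Real.coe_toNNReal _ (by positivity)]
      refine ((A t).le_of_opNorm_le (hE t ht) _).trans ?_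
      gcongr
      exact hD x
    · simp
  obtain ⟨f, hf1, hf⟩ := hPL.exists_eq_forall_mem_Icc_hasDerivWithinAt₀
  have hf1 : f 1 = w := hf1
  refine ⟨f, hf1, fun s hs => ?_⟩
  have hn : ∀ s ∈ Icc (0:ℝ) 1, ‖f s‖ ≤ ‖w‖ := by
    intro s hs
    have := energy_est (fun t => χ (f t) • A t) f (fun _ => 0) 0 0
      (by intro t ht; simpa using hf t ht)
      (by intro t ht v; simp [inner_smul_left, hA t ht]) (by simp) s hs
    simpa [hf1] using this
  have h1 : χ (f s) = 1 := by
    apply χ.one_of_mem_closedBall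
    have := hn s hs
    simp [χ]; linarith
  simpa [h1] using hf s hs

/-- Abstract holonomy estimate on the unit square. -/
theorem holonomy_square {F : Type*} [NormedAddCommGroup F] [InnerProductSpace ℝ F]
    (A B E E' : ℝ → ℝ → F →L[ℝ] F) (f : ℝ → ℝ → F) (w : ℝ → F) (C N : ℝ)
    (hN : 0 ≤ N)
    (hA : ∀ s ∈ Icc (0:ℝ) 1, ∀ t ∈ Icc (0:ℝ) 1, ∀ v : F, ⟪A s t v, v⟫ = 0)
    (hAB : ∀ s ∈ Icc (0:ℝ) 1, ∀ t ∈ Icc (0:ℝ) 1,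
      HasDerivWithinAt (fun t => A s t) (B s t) (Icc (0:ℝ) 1) t)
    (hB : ContinuousOn (fun p : ℝ × ℝ => B p.1 p.2) (Icc (0:ℝ) 1 ×ˢ Icc (0:ℝ) 1))
    (hE : ∀ s ∈ Icc (0:ℝ) 1, ∀ t ∈ Icc (0:ℝ) 1,
      HasDerivWithinAt (fun s => E s t) (E' s t) (Icc (0:ℝ) 1) s)
    (hE0 : ∀ t ∈ Icc (0:ℝ) 1, E 0 t = 0)
    (hf : ∀ s ∈ Icc (0:ℝ) 1, ∀ t ∈ Icc (0:ℝ) 1,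
      HasDerivWithinAt (fun s => f s t) (-(A s t (f s t))) (Icc (0:ℝ) 1) s)
    (hf1 : ∀ t ∈ Icc (0:ℝ) 1, f 1 t = w t)
    (hw : ∀ t ∈ Icc (0:ℝ) 1, HasDerivWithinAt w (-(E 1 t (w t))) (Icc (0:ℝ) 1) t)
    (hwN : ∀ t ∈ Icc (0:ℝ) 1, ‖w t‖ ≤ N)
    (hK : ∀ s ∈ Icc (0:ℝ) 1, ∀ t ∈ Icc (0:ℝ) 1,
      ‖E' s t - B s t + (A s t).comp (E s t) - (E s t).comp (A s t)‖ ≤ C * s) :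
    ‖f 0 1 - f 0 0‖ ≤ C / 2 * N := by
  have h0m : (0:ℝ) ∈ Icc (0:ℝ) 1 := by simp
  have h1m : (1:ℝ) ∈ Icc (0:ℝ) 1 := by simp
  have hfN : ∀ s ∈ Icc (0:ℝ) 1, ∀ t ∈ Icc (0:ℝ) 1, ‖f s t‖ ≤ N := by
    intro s hs t ht
    have := energy_est (fun s => A s t) (fun s => f s t) (fun _ => 0) 0 0
      (by intro s hs; simpa using hf s hs t ht) (fun s hs => hA s hs t ht) (by simp) s hs
    simp only [zero_mul, zero_div, add_zero, hf1 t ht] at this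
    exact this.trans (hwN t ht)
  have hcpt : IsCompact (Icc (0:ℝ) 1 ×ˢ Icc (0:ℝ) 1) := isCompact_Icc.prod isCompact_Icc
  obtain ⟨L, hL⟩ := hcpt.exists_bound_of_continuousOn hB
  have hL' : ∀ s ∈ Icc (0:ℝ) 1, ∀ t ∈ Icc (0:ℝ) 1, ‖B s t‖ ≤ L :=
    fun s hs t ht => hL (s, t) ⟨hs, ht⟩
  have hL0 : 0 ≤ L := (norm_nonneg _).trans (hL' 0 h0m 0 h0m)
  have hUC := hcpt.uniformContinuousOn_of_continuous hB
  have hALip : ∀ s ∈ Icc (0:ℝ) 1, ∀ t ∈ Icc (0:ℝ) 1, ∀ t' ∈ Icc (0:ℝ) 1,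
      ‖A s t' - A s t‖ ≤ L * |t' - t| := fun s hs t ht t' ht' =>
    Convex.norm_image_sub_le_of_norm_hasDerivWithin_le (f := fun t => A s t)
      (fun t ht => hAB s hs t ht) (fun t ht => hL' s hs t ht) (convex_Icc 0 1) ht ht'
  have hdiff : ∀ t ∈ Icc (0:ℝ) 1, ∀ t' ∈ Icc (0:ℝ) 1, ∀ s ∈ Icc (0:ℝ) 1,
      ‖f s t' - f s t‖ ≤ ‖w t' - w t‖ + L * |t' - t| * N := by
    intro t ht t' ht' s hs
    have := energy_est (fun s => A s t) (fun s => f s t' - f s t)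
      (fun s => -((A s t' - A s t) (f s t'))) 0 (L * |t' - t| * N)
      (by
        intro s hs
        refine ((hf s hs t' ht').sub (hf s hs t ht)).congr_deriv ?_
        simp only [map_sub, _root_.sub_apply]
        abel)
      (fun s hs => hA s hs t ht)
      (by
        intro s hs
        rw [norm_neg, zero_mul, zero_add]
        refine ((A s t' - A s t).le_of_opNorm_le (hALip s hs t ht t' ht') _).trans ?_
        gcongr
        exact hfN s hs t' ht') s hs
    simp only [hf1 t ht, hf1 t' ht', zero_mul, zero_div, add_zero] at this
    have h3 : 0 ≤ L * |t' - t| * N * s := by have := hs.1; positivity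
    linarith
  have hcont : ContinuousOn (fun t => f 0 t) (Icc (0:ℝ) 1) := by
    intro t ht
    rw [ContinuousWithinAt, tendsto_iff_norm_sub_tendsto_zero]
    have hlim : Filter.Tendsto (fun t' => ‖w t' - w t‖ + L * |t' - t| * N)
        (nhdsWithin t (Icc (0:ℝ) 1)) (nhds 0) := by
      have hc : ContinuousWithinAt (fun t' => ‖w t' - w t‖ + L * |t' - t| * N) (Icc (0:ℝ) 1) t := by
        have := (hw t ht).continuousWithinAt
        fun_prop
      simpa [ContinuousWithinAt] using hc
    refine squeeze_zero' (Filter.Eventually.of_forall fun _ => norm_nonneg _) ?_ hlim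
    filter_upwards [self_mem_nhdsWithin] with t' ht'
    exact hdiff t ht t' ht' 0 h0m
  have hkey : ∀ t ∈ Icc (0:ℝ) 1, ∀ ε > 0, ∀ᶠ t' in nhdsWithin t (Icc (0:ℝ) 1),
      ‖f 0 t' - f 0 t‖ ≤ (C / 2 * N + ε) * |t' - t| := by
    intro t ht ε hε
    set ε₁ := ε / (2 * N + L + 1) / 2 with hε₁
    have hden : 0 < 2 * N + L + 1 := by positivity
    have hε₁0 : 0 < ε₁ := by positivity
    have hε₁' : ε₁ * (N + L + 1) ≤ ε := by
      have : ε₁ * (2 * N + L + 1) = ε / 2 := by rw [hε₁]; field_simp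
      nlinarith
    -- smallness of the tangential remainder
    have e1 : ∀ᶠ t' in nhdsWithin t (Icc (0:ℝ) 1),
        ‖w t' - w t - (t' - t) • (-(E 1 t (w t)))‖ ≤ ε₁ * ‖t' - t‖ :=
      (hasDerivWithinAt_iff_isLittleO.1 (hw t ht)).def hε₁0
    -- smallness of the differences
    have e2 : ∀ᶠ t' in nhdsWithin t (Icc (0:ℝ) 1),
        ‖w t' - w t‖ + L * |t' - t| * N < ε₁ := by
      have hc : ContinuousWithinAt (fun t' => ‖w t' - w t‖ + L * |t' - t| * N) (Icc (0:ℝ) 1) t := by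
        have := (hw t ht).continuousWithinAt
        fun_prop
      have hc' : Filter.Tendsto (fun t' => ‖w t' - w t‖ + L * |t' - t| * N)
        (nhdsWithin t (Icc (0:ℝ) 1)) (nhds 0) := by simpa [ContinuousWithinAt] using hc
      exact hc'.eventually_lt_const hε₁0
    obtain ⟨δ, hδ, hδB⟩ := Metric.uniformContinuousOn_iff.1 hUC ε₁ hε₁0
    have e3 : ∀ᶠ t' in nhdsWithin t (Icc (0:ℝ) 1), t' ∈ Metric.ball t δ :=
      mem_nhdsWithin_of_mem_nhds (Metric.ball_mem_nhds t hδ)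
    filter_upwards [e1, e2, e3, self_mem_nhdsWithin] with t' h1 h2 h3 ht'
    set h := t' - t with hh
    have hrem : ∀ s ∈ Icc (0:ℝ) 1, ‖A s t' - A s t - h • B s t‖ ≤ ε₁ * |h| := by
      intro s hs
      have hsub : Set.uIcc t t' ⊆ Icc (0:ℝ) 1 := Set.uIcc_subset_Icc ht ht'
      have := Convex.norm_image_sub_le_of_norm_hasDerivWithin_le
        (f := fun τ => A s τ - τ • B s t) (f' := fun τ => B s τ - B s t) (s := Set.uIcc t t')
        (x := t) (y := t') (C := ε₁)
        (by
          intro τ hτ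
          have h5 := ((hasDerivAt_id τ).smul_const (B s t)).hasDerivWithinAt (s := Set.uIcc t t')
          refine (((hAB s hs τ (hsub hτ)).mono hsub).sub h5).congr_deriv ?_
          simp)
        (by
          intro τ hτ
          have := hδB (s, τ) ⟨hs, hsub hτ⟩ (s, t) ⟨hs, ht⟩ (by
            rw [Prod.dist_eq]
            simp only [dist_self]
            rw [max_eq_right dist_nonneg, Real.dist_eq]
            refine lt_of_le_of_lt ?_ (Metric.mem_ball.1 h3)
            rw [Real.dist_eq]
            exact Set.abs_sub_left_of_mem_uIcc hτ)
          rw [dist_eq_norm] at this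
          exact this.le)
        (convex_uIcc t t') Set.left_mem_uIcc Set.right_mem_uIcc
      refine le_trans (le_of_eq ?_) this
      congr 1
      rw [hh, sub_smul]; abel
    have hest := energy_est (fun s => A s t)
      (fun s => f s t' - f s t + h • (E s t (f s t)))
      (fun s => h • ((E' s t - B s t + (A s t).comp (E s t) - (E s t).comp (A s t)) (f s t))
        - (A s t' - A s t - h • B s t) (f s t') - h • (B s t (f s t' - f s t)))
      (|h| * (C * N)) (ε₁ * |h| * N + |h| * (L * ε₁))
      (by
        intro s hs
        refine (((hf s hs t' ht').sub (hf s hs t ht)).add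
          (((hE s hs t ht).clm_apply (hf s hs t ht)).const_smul h)).congr_deriv ?_
        simp only [map_sub, map_add, map_smul, map_neg, _root_.sub_apply,
          _root_.add_apply, _root_.smul_apply,
          ContinuousLinearMap.comp_apply, smul_add, smul_sub, smul_neg]
        abel)
      (fun s hs => hA s hs t ht)
      (by
        intro s hs
        have b1 : ‖h • ((E' s t - B s t + (A s t).comp (E s t) - (E s t).comp (A s t)) (f s t))‖
            ≤ |h| * ((C * s) * N) := by
          rw [norm_smul, Real.norm_eq_abs]
          gcongr
          exact (ContinuousLinearMap.le_of_opNorm_le _ (hK s hs t ht) _).trans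
            (mul_le_mul_of_nonneg_left (hfN s hs t ht) ((norm_nonneg _).trans (hK s hs t ht)))
        have b2 : ‖(A s t' - A s t - h • B s t) (f s t')‖ ≤ ε₁ * |h| * N :=
          (ContinuousLinearMap.le_of_opNorm_le _ (hrem s hs) _).trans
            (mul_le_mul_of_nonneg_left (hfN s hs t' ht') (by positivity))
        have b3 : ‖h • (B s t (f s t' - f s t))‖ ≤ |h| * (L * ε₁) := by
          rw [norm_smul, Real.norm_eq_abs]
          gcongr
          exact (ContinuousLinearMap.le_of_opNorm_le _ (hL' s hs t ht) _).trans
            (mul_le_mul_of_nonneg_left ((hdiff t ht t' ht' s hs).trans h2.le) hL0)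
        refine (norm_sub_le _ _).trans ?_
        have := norm_sub_le (h • ((E' s t - B s t + (A s t).comp (E s t) - (E s t).comp (A s t)) (f s t))) ((A s t' - A s t - h • B s t) (f s t'))
        linarith)
      0 h0m
    simp only [hE0 t ht, hf1 t ht, hf1 t' ht', _root_.zero_apply, smul_zero,
      add_zero] at hest
    have h4 : ‖w t' - w t + h • (E 1 t (w t))‖ ≤ ε₁ * |h| := by
      simpa [smul_neg, sub_neg_eq_add, Real.norm_eq_abs] using h1
    have h5 : ε₁ * (N + L + 1) * |h| ≤ ε * |h| := by gcongr
    nlinarith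
  -- conclude
  refine le_of_forall_pos_le_add fun ε hε => ?_
  have hfin := image_norm_le_of_liminf_right_slope_norm_lt_deriv_boundary
    (f := fun t => f 0 t - f 0 0) (a := 0) (b := 1) (f' := fun _ => C / 2 * N + ε / 2)
    (B := fun t => (C / 2 * N + ε) * t) (B' := fun _ => C / 2 * N + ε)
    (hcont.sub continuousOn_const)
    (by
      intro t ht r hr
      have ht1 : t ∈ Icc (0:ℝ) 1 := ⟨ht.1, ht.2.le⟩
      have h1 := hkey t ht1 (ε / 2) (by positivity)
      have hle : nhdsWithin t (Ioi t) ≤ nhdsWithin t (Icc (0:ℝ) 1) := by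
        rw [← nhdsWithin_Ioo_eq_nhdsGT ht.2]
        exact nhdsWithin_mono _ fun τ hτ => ⟨ht.1.trans hτ.1.le, hτ.2.le⟩
      refine Filter.Eventually.frequently ?_
      filter_upwards [hle h1, self_mem_nhdsWithin] with t' h2 ht'
      have hpos : 0 < t' - t := sub_pos.2 ht'
      rw [slope_def_field]
      refine lt_of_le_of_lt ?_ hr
      rw [div_le_iff₀ hpos]
      have h3 := norm_sub_norm_le (f 0 t' - f 0 0) (f 0 t - f 0 0)
      rw [sub_sub_sub_cancel_right] at h3
      rw [abs_of_pos hpos] at h2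
      exact h3.trans h2)
    (by simp) (by fun_prop)
    (fun t _ => by simpa using ((hasDerivAt_id t).const_mul (C / 2 * N + ε)).hasDerivWithinAt)
    (fun t _ _ => by linarith) h1m
  simpa using hfin

theorem curv_bound {V G : Type*} [NormedAddCommGroup V] [InnerProductSpace ℝ V]
    [NormedAddCommGroup G] [NormedSpace ℝ G] (K : V → V → G) (M : ℝ) (hM : 0 ≤ M)
    (hadd : ∀ v w (c : ℝ), K v (w - c • v) = K v w)
    (hsm : ∀ v w (a b : ℝ), K (a • v) (b • w) = (a * b) • K v w)
    (hK : ∀ v w, ‖v‖ = 1 → ‖w‖ = 1 → ‖K v w‖ ≤ M) (v w : V) :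
    ‖K v w‖ ≤ M * Real.sqrt (‖v‖ ^ 2 * ‖w‖ ^ 2 - ⟪v, w⟫ ^ 2) := by
  have hgen : ∀ v w, ‖K v w‖ ≤ M * (‖v‖ * ‖w‖) := by
    intro v w
    by_cases hv : v = 0
    · have := hsm 0 w 0 1
      simp at this
      simp [hv, this]
    by_cases hw : w = 0
    · have := hsm v 0 1 0
      simp at this
      simp [hw, this]
    have hv' := norm_ne_zero_iff.2 hv
    have hw' := norm_ne_zero_iff.2 hw
    have h1 := hK (‖v‖⁻¹ • v) (‖w‖⁻¹ • w) (by simp [norm_smul, hv']) (by simp [norm_smul, hw'])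
    have h2 := hsm (‖v‖⁻¹ • v) (‖w‖⁻¹ • w) ‖v‖ ‖w‖
    rw [smul_inv_smul₀ hv', smul_inv_smul₀ hw'] at h2
    rw [h2, norm_smul, norm_mul, norm_norm, norm_norm, mul_comm]
    gcongr
  by_cases hv : v = 0
  · have := hsm 0 w 0 1
    simp at this
    simp [hv, this]
  have hv' := norm_ne_zero_iff.2 hv
  rw [← hadd v w (⟪v, w⟫ / ‖v‖ ^ 2)]
  refine (hgen _ _).trans ?_
  gcongr
  apply Real.le_sqrt_of_sq_le
  apply le_of_eq
  rw [mul_pow, @norm_sub_sq_real, norm_smul, inner_smul_right, real_inner_comm, mul_pow,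
    Real.norm_eq_abs, sq_abs, real_inner_comm]
  field_simp
  ring

theorem chain_aux {V G : Type*} [NormedAddCommGroup V] [NormedSpace ℝ V]
    [NormedAddCommGroup G] [NormedSpace ℝ G] (f : V → G) (f' : V →L[ℝ] G) (H : Set V)
    (g : ℝ → V) (g' : V) (I : Set ℝ) (t : ℝ) (hf : HasFDerivWithinAt f f' H (g t))
    (hg : HasDerivWithinAt g g' I t) (hm : MapsTo g I H) :
    HasDerivWithinAt (fun t => f (g t)) (f' g') I t :=
  hf.comp_hasDerivWithinAt t hg hm

theorem holonomy_triangle {V F : Type*} [NormedAddCommGroup V] [InnerProductSpace ℝ V]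
    [NormedAddCommGroup F] [InnerProductSpace ℝ F] [FiniteDimensional ℝ F]
    (H : Set V) (hH : Convex ℝ H)
    (Γ : V → V →L[ℝ] F →L[ℝ] F) (DΓ : V → V →L[ℝ] V →L[ℝ] F →L[ℝ] F)
    (hΓ : ∀ w ∈ H, HasFDerivWithinAt Γ (DΓ w) H w)
    (hΓcont : ContinuousOn Γ H) (hDΓcont : ContinuousOn DΓ H)
    (hskew : ∀ w ∈ H, ∀ (v : V) (u : F), ⟪Γ w v u, u⟫ = 0)
    (x y z : V) (hx : x ∈ H) (hy : y ∈ H) (hz : z ∈ H) (w fy fz : ℝ → F)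
    (hw : ∀ t ∈ Icc (0:ℝ) 1, HasDerivWithinAt w
      (-(Γ ((1 - t) • y + t • z) (z - y) (w t))) (Icc (0:ℝ) 1) t)
    (hfy : ∀ t ∈ Icc (0:ℝ) 1, HasDerivWithinAt fy
      (-(Γ ((1 - t) • x + t • y) (y - x) (fy t))) (Icc (0:ℝ) 1) t)
    (hfy1 : fy 1 = w 0)
    (hfz : ∀ t ∈ Icc (0:ℝ) 1, HasDerivWithinAt fz
      (-(Γ ((1 - t) • x + t • z) (z - x) (fz t))) (Icc (0:ℝ) 1) t)
    (hfz1 : fz 1 = w 1) (M : ℝ) (hM : 0 ≤ M)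
    (hK : ∀ p ∈ H, ∀ v₁ v₂ : V, ‖v₁‖ = 1 → ‖v₂‖ = 1 →
          ‖DΓ p v₁ v₂ - DΓ p v₂ v₁ + (Γ p v₁).comp (Γ p v₂) - (Γ p v₂).comp (Γ p v₁)‖ ≤ M) :
    ‖fz 0 - fy 0‖ ≤
      (M * Real.sqrt (‖y - x‖ ^ 2 * ‖z - x‖ ^ 2 - ⟪y - x, z - x⟫ ^ 2)) / 2 * ‖w 1‖ := by
  have h0m : (0:ℝ) ∈ Icc (0:ℝ) 1 := by simp
  have h1m : (1:ℝ) ∈ Icc (0:ℝ) 1 := by simp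
  set S := Real.sqrt (‖y - x‖ ^ 2 * ‖z - x‖ ^ 2 - ⟪y - x, z - x⟫ ^ 2) with hS
  let c : ℝ → V := fun t => (1 - t) • y + t • z
  let σ : ℝ → ℝ → V := fun s t => (1 - s) • x + s • c t
  have hc : ∀ t ∈ Icc (0:ℝ) 1, c t ∈ H := fun t ht =>
    hH hy hz (sub_nonneg.2 ht.2) ht.1 (by ring)
  have hσ : ∀ s ∈ Icc (0:ℝ) 1, ∀ t ∈ Icc (0:ℝ) 1, σ s t ∈ H := fun s hs t ht =>
    hH hx (hc t ht) (sub_nonneg.2 hs.2) hs.1 (by ring)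
  have hcd : ∀ t, HasDerivAt c (z - y) t := by
    intro t
    have h1 := (((hasDerivAt_id t).const_sub 1).smul_const y).add ((hasDerivAt_id t).smul_const z)
    refine h1.congr_deriv ?_
    simp; abel
  have hσt : ∀ s t, HasDerivAt (fun t => σ s t) (s • (z - y)) t := by
    intro s t
    exact ((hcd t).const_smul s).const_add _
  have hσs : ∀ s t, HasDerivAt (fun s => σ s t) (c t - x) s := by
    intro s t
    have h1 := (((hasDerivAt_id s).const_sub 1).smul_const x).add
      ((hasDerivAt_id s).smul_const (c t))
    refine h1.congr_deriv ?_
    simp; abel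
  have hσc : Continuous (fun p : ℝ × ℝ => σ p.1 p.2) := by
    simp only [σ, c]; fun_prop
  have hcc : Continuous c := by
    simp only [c]; fun_prop
  have hmaps : MapsTo (fun p : ℝ × ℝ => σ p.1 p.2) (Icc (0:ℝ) 1 ×ˢ Icc (0:ℝ) 1) H :=
    fun p hp => hσ p.1 hp.1 p.2 hp.2
  have hΓσt : ∀ s ∈ Icc (0:ℝ) 1, ∀ t ∈ Icc (0:ℝ) 1, HasDerivWithinAt (fun t => Γ (σ s t))
      (DΓ (σ s t) (s • (z - y))) (Icc (0:ℝ) 1) t := fun s hs t ht =>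
    chain_aux (G := V →L[ℝ] F →L[ℝ] F) Γ (DΓ (σ s t)) H (fun t => σ s t) _ _ t
      (hΓ _ (hσ s hs t ht)) (hσt s t).hasDerivWithinAt (fun τ hτ => hσ s hs τ hτ)
  have hΓσs : ∀ s ∈ Icc (0:ℝ) 1, ∀ t ∈ Icc (0:ℝ) 1, HasDerivWithinAt (fun s => Γ (σ s t))
      (DΓ (σ s t) (c t - x)) (Icc (0:ℝ) 1) s := fun s hs t ht =>
    chain_aux (G := V →L[ℝ] F →L[ℝ] F) Γ (DΓ (σ s t)) H (fun s => σ s t) _ _ s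
      (hΓ _ (hσ s hs t ht)) (hσs s t).hasDerivWithinAt (fun τ hτ => hσ τ hτ t ht)
  have hex : ∀ t : ℝ, ∃ f : ℝ → F, t ∈ Icc (0:ℝ) 1 → (f 1 = w t ∧
      ∀ s ∈ Icc (0:ℝ) 1, HasDerivWithinAt f (-(Γ (σ s t) (c t - x) (f s))) (Icc (0:ℝ) 1) s) := by
    intro t
    by_cases ht : t ∈ Icc (0:ℝ) 1
    · obtain ⟨f, h1, h2⟩ := ode_exists (fun s => Γ (σ s t) (c t - x)) (w t)
        ((hΓcont.comp (f := fun s => σ s t) (s := Icc (0:ℝ) 1)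
          (Continuous.continuousOn (by simp only [σ]; fun_prop))
          (fun s hs => hσ s hs t ht)).clm_apply continuousOn_const)
        (fun s hs v => hskew _ (hσ s hs t ht) _ _)
      exact ⟨f, fun _ => ⟨h1, h2⟩⟩
    · exact ⟨0, fun h => absurd h ht⟩
  choose f hf using hex
  -- norm of w
  have hwN : ∀ t ∈ Icc (0:ℝ) 1, ‖w t‖ ≤ ‖w 1‖ := by
    intro t ht
    have := energy_est (fun s => Γ (c s) (z - y)) w (fun _ => 0) 0 0
      (by intro s hs; simpa using hw s hs) (fun s hs v => hskew _ (hc s hs) _ _) (by simp) t ht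
    simpa using this
  -- uniqueness
  have huniq : ∀ t ∈ Icc (0:ℝ) 1, ∀ g : ℝ → F, g 1 = w t →
      (∀ s ∈ Icc (0:ℝ) 1, HasDerivWithinAt g (-(Γ (σ s t) (c t - x) (g s))) (Icc (0:ℝ) 1) s) →
      g 0 = f t 0 := by
    intro t ht g hg1 hg
    have := energy_est (fun s => Γ (σ s t) (c t - x)) (fun s => g s - f t s) (fun _ => 0) 0 0
      (by
        intro s hs
        refine ((hg s hs).sub ((hf t ht).2 s hs)).congr_deriv ?_
        simp only [map_sub]; abel)
      (fun s hs v => hskew _ (hσ s hs t ht) _ _) (by simp) 0 h0m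
    simp [hg1, (hf t ht).1] at this
    exact sub_eq_zero.1 this
  have hy0 : fy 0 = f 0 0 := huniq 0 h0m fy hfy1 (by
    intro s hs
    have := hfy s hs
    simpa [σ, c] using this)
  have hz0 : fz 0 = f 1 0 := huniq 1 h1m fz hfz1 (by
    intro s hs
    have := hfz s hs
    simpa [σ, c] using this)
  rw [hy0, hz0]
  refine holonomy_square (fun s t => Γ (σ s t) (c t - x))
    (fun s t => DΓ (σ s t) (s • (z - y)) (c t - x) + Γ (σ s t) (z - y))
    (fun s t => s • Γ (σ s t) (z - y))
    (fun s t => s • DΓ (σ s t) (c t - x) (z - y) + Γ (σ s t) (z - y))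
    (fun s t => f t s) w (M * S) ‖w 1‖ (norm_nonneg _) ?_ ?_ ?_ ?_ ?_ ?_ ?_ ?_ hwN ?_
  · intro s hs t ht v
    exact hskew _ (hσ s hs t ht) _ _
  · intro s hs t ht
    exact (hΓσt s hs t ht).clm_apply ((hcd t).sub_const x).hasDerivWithinAt
  · have h1 : ContinuousOn (fun p : ℝ × ℝ => Γ (σ p.1 p.2)) (Icc (0:ℝ) 1 ×ˢ Icc (0:ℝ) 1) :=
      hΓcont.comp hσc.continuousOn hmaps
    have h2 : ContinuousOn (fun p : ℝ × ℝ => DΓ (σ p.1 p.2)) (Icc (0:ℝ) 1 ×ˢ Icc (0:ℝ) 1) :=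
      hDΓcont.comp hσc.continuousOn hmaps
    refine ((h2.clm_apply ?_).clm_apply ?_).add (h1.clm_apply continuousOn_const)
    · exact Continuous.continuousOn (by fun_prop)
    · exact Continuous.continuousOn (by fun_prop)
  · intro s hs t ht
    have h1 := (hΓσs s hs t ht).clm_apply (hasDerivWithinAt_const s (Icc (0:ℝ) 1) (z - y))
    refine ((hasDerivWithinAt_id s (Icc (0:ℝ) 1)).smul h1).congr_deriv ?_
    simp
  · intro t ht; simp
  · intro s hs t ht
    exact (hf t ht).2 s hs
  · intro t ht
    exact (hf t ht).1
  · intro t ht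
    have := hw t ht
    simpa [σ, c] using this
  · intro s hs t ht
    have hp := hσ s hs t ht
    have hb := curv_bound (fun v₁ v₂ => DΓ (σ s t) v₁ v₂ - DΓ (σ s t) v₂ v₁
        + (Γ (σ s t) v₁).comp (Γ (σ s t) v₂) - (Γ (σ s t) v₂).comp (Γ (σ s t) v₁)) M hM
      (by
        intro v w a
        ext u
        simp only [map_sub, map_smul, _root_.sub_apply, _root_.add_apply, _root_.smul_apply,
          ContinuousLinearMap.comp_apply]
        abel)
      (by
        intro v w a b
        ext u
        simp only [map_sub, map_smul, _root_.sub_apply, _root_.add_apply, _root_.smul_apply,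
          ContinuousLinearMap.comp_apply, smul_add, smul_sub, smul_smul, mul_comm b a])
      (hK _ hp) (c t - x) (z - y)
    have hgram : ‖c t - x‖ ^ 2 * ‖z - y‖ ^ 2 - ⟪c t - x, z - y⟫ ^ 2
        = ‖y - x‖ ^ 2 * ‖z - x‖ ^ 2 - ⟪y - x, z - x⟫ ^ 2 := by
      have e1 : c t - x = (1 - t) • (y - x) + t • (z - x) := by
        simp only [c]; module
      have e2 : z - y = (z - x) - (y - x) := by abel
      rw [e1, e2]
      generalize y - x = p
      generalize z - x = q
      simp only [← real_inner_self_eq_norm_sq, inner_add_left, inner_add_right, inner_sub_left,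
        inner_sub_right, real_inner_smul_left, real_inner_smul_right, real_inner_comm p q]
      ring
    rw [hgram, ← hS] at hb
    have heq : (s • DΓ (σ s t) (c t - x) (z - y) + Γ (σ s t) (z - y))
        - (DΓ (σ s t) (s • (z - y)) (c t - x) + Γ (σ s t) (z - y))
        + (Γ (σ s t) (c t - x)).comp (s • Γ (σ s t) (z - y))
        - (s • Γ (σ s t) (z - y)).comp (Γ (σ s t) (c t - x))
        = s • (DΓ (σ s t) (c t - x) (z - y) - DΓ (σ s t) (z - y) (c t - x)
        + (Γ (σ s t) (c t - x)).comp (Γ (σ s t) (z - y))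
        - (Γ (σ s t) (z - y)).comp (Γ (σ s t) (c t - x))) := by
      rw [map_smul, _root_.smul_apply, ContinuousLinearMap.comp_smul,
        ContinuousLinearMap.smul_comp]
      module
    simp only [heq]
    rw [norm_smul, Real.norm_eq_abs, abs_of_nonneg hs.1, mul_comm]
    exact mul_le_mul_of_nonneg_right hb hs.1

/-- Triangle-type estimate with a holonomy error term:
`‖U(x) − R^Γ(x,y)U(y)‖ ≤ ‖U(x) − R^Γ(x,z)U(z)‖ + ‖U(y) − R^Γ(y,z)U(z)‖
  + ‖U(z)‖ · min{2, ‖K_Γ‖_∞ |Δ_{x,y,z}|}`, stated for every upper bound `M ≥ 0` of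
`‖K_Γ‖` over the closed half-space and unit vectors. -/
theorem holonomy_triangle_inequality_halfspace
    {F : Type*} [NormedAddCommGroup F] [InnerProductSpace ℝ F] [FiniteDimensional ℝ F]
    {n : ℕ} (hn : 1 ≤ n)
    -- Γ of class C¹ on the closed half-space, with skew-adjoint values
    (Γ : EuclideanSpace ℝ (Fin (n + 1)) →
      EuclideanSpace ℝ (Fin (n + 1)) →L[ℝ] F →L[ℝ] F)
    (DΓ : EuclideanSpace ℝ (Fin (n + 1)) →
      EuclideanSpace ℝ (Fin (n + 1)) →L[ℝ] EuclideanSpace ℝ (Fin (n + 1)) →L[ℝ] F →L[ℝ] F)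
    (hΓ : ∀ w ∈ closedHalfSpace n, HasFDerivWithinAt Γ (DΓ w) (closedHalfSpace n) w)
    (hΓcont : ContinuousOn Γ (closedHalfSpace n))
    (hDΓcont : ContinuousOn DΓ (closedHalfSpace n))
    (hskew : ∀ w ∈ closedHalfSpace n, ∀ (v : EuclideanSpace ℝ (Fin (n + 1))) (u₁ u₂ : F),
      ⟪(Γ w v) u₁, u₂⟫ = -⟪u₁, (Γ w v) u₂⟫)
    -- U of class C¹ on the closed half-space
    (U : EuclideanSpace ℝ (Fin (n + 1)) → F)
    (hU : ContDiffOn ℝ 1 U (closedHalfSpace n))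
    -- the points x, y, z in the closed half-space
    (x y z : EuclideanSpace ℝ (Fin (n + 1)))
    (hx : x ∈ closedHalfSpace n) (hy : y ∈ closedHalfSpace n) (hz : z ∈ closedHalfSpace n)
    -- the parallel transports R^Γ(x,y) = Pxy 0, R^Γ(x,z) = Pxz 0, R^Γ(y,z) = Pyz 0
    (Pxy Pxz Pyz : ℝ → F →L[ℝ] F)
    (hPxy : ∀ t ∈ Icc (0:ℝ) 1, HasDerivWithinAt Pxy
      (-((Γ ((1 - t) • x + t • y)) (y - x)).comp (Pxy t)) (Icc (0:ℝ) 1) t)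
    (hPxy1 : Pxy 1 = ContinuousLinearMap.id ℝ F)
    (hPxz : ∀ t ∈ Icc (0:ℝ) 1, HasDerivWithinAt Pxz
      (-((Γ ((1 - t) • x + t • z)) (z - x)).comp (Pxz t)) (Icc (0:ℝ) 1) t)
    (hPxz1 : Pxz 1 = ContinuousLinearMap.id ℝ F)
    (hPyz : ∀ t ∈ Icc (0:ℝ) 1, HasDerivWithinAt Pyz
      (-((Γ ((1 - t) • y + t • z)) (z - y)).comp (Pyz t)) (Icc (0:ℝ) 1) t)
    (hPyz1 : Pyz 1 = ContinuousLinearMap.id ℝ F) :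
    ∀ M : ℝ, 0 ≤ M →
      (∀ w ∈ closedHalfSpace n,
        ∀ v₁ v₂ : EuclideanSpace ℝ (Fin (n + 1)), ‖v₁‖ = 1 → ‖v₂‖ = 1 →
          ‖((DΓ w) v₁) v₂ - ((DΓ w) v₂) v₁
            + ((Γ w) v₁).comp ((Γ w) v₂) - ((Γ w) v₂).comp ((Γ w) v₁)‖ ≤ M) →
      ‖U x - (Pxy 0) (U y)‖
        ≤ ‖U x - (Pxz 0) (U z)‖ + ‖U y - (Pyz 0) (U z)‖
          + ‖U z‖ * min 2
              (M * ((1 / 2) * Real.sqrt (‖y - x‖ ^ 2 * ‖z - x‖ ^ 2 - ⟪y - x, z - x⟫ ^ 2))) := by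
  intro M hM hK
  have h0m : (0:ℝ) ∈ Icc (0:ℝ) 1 := by simp
  have hH : Convex ℝ (closedHalfSpace n) := by
    intro p hp q hq a b ha hb _
    simp only [closedHalfSpace, mem_ofPred_eq] at hp hq ⊢
    simp only [PiLp.add_apply, PiLp.smul_apply, smul_eq_mul]
    positivity
  have hsk : ∀ w ∈ closedHalfSpace n, ∀ (v : EuclideanSpace ℝ (Fin (n + 1))) (u : F),
      ⟪Γ w v u, u⟫ = 0 := by
    intro w hw v u
    have h1 := hskew w hw v u u
    rw [real_inner_comm u] at h1
    linarith [real_inner_comm u (Γ w v u)]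
  have happ : ∀ (p q : EuclideanSpace ℝ (Fin (n + 1))) (P : ℝ → F →L[ℝ] F) (u : F),
      (∀ t ∈ Icc (0:ℝ) 1, HasDerivWithinAt P
        (-((Γ ((1 - t) • p + t • q)) (q - p)).comp (P t)) (Icc (0:ℝ) 1) t) →
      ∀ t ∈ Icc (0:ℝ) 1, HasDerivWithinAt (fun t => P t u)
        (-(Γ ((1 - t) • p + t • q) (q - p) (P t u))) (Icc (0:ℝ) 1) t := by
    intro p q P u hP t ht
    refine ((hP t ht).clm_apply (hasDerivWithinAt_const t (Icc (0:ℝ) 1) u)).congr_deriv ?_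
    simp
  have hnorm : ∀ (p q : EuclideanSpace ℝ (Fin (n + 1))) (P : ℝ → F →L[ℝ] F) (u : F),
      p ∈ closedHalfSpace n → q ∈ closedHalfSpace n →
      (∀ t ∈ Icc (0:ℝ) 1, HasDerivWithinAt P
        (-((Γ ((1 - t) • p + t • q)) (q - p)).comp (P t)) (Icc (0:ℝ) 1) t) →
      P 1 = ContinuousLinearMap.id ℝ F → ‖P 0 u‖ ≤ ‖u‖ := by
    intro p q P u hp hq hP hP1
    have := energy_est (fun t => Γ ((1 - t) • p + t • q) (q - p)) (fun t => P t u)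
      (fun _ => 0) 0 0
      (by intro s hs; simpa using happ p q P u hP s hs)
      (fun s hs v => hsk _ (hH hp hq (sub_nonneg.2 hs.2) hs.1 (by ring)) _ _) (by simp) 0 h0m
    simpa [hP1] using this
  have hhol := holonomy_triangle (closedHalfSpace n) hH Γ DΓ hΓ hΓcont hDΓcont hsk x y z hx hy hz
    (fun t => Pyz t (U z)) (fun t => Pxy t (Pyz 0 (U z))) (fun t => Pxz t (U z))
    (happ y z Pyz (U z) hPyz) (happ x y Pxy _ hPxy) (by simp [hPxy1])
    (happ x z Pxz _ hPxz) (by simp [hPxz1, hPyz1]) M hM hK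
  simp only [hPyz1, ContinuousLinearMap.id_apply] at hhol
  have h1 := hnorm x z Pxz (U z) hx hz hPxz hPxz1
  have h2 := hnorm x y Pxy (Pyz 0 (U z)) hx hy hPxy hPxy1
  have h3 := hnorm y z Pyz (U z) hy hz hPyz hPyz1
  have h4 := hnorm x y Pxy (Pyz 0 (U z) - U y) hx hy hPxy hPxy1
  have h5 : ‖Pxz 0 (U z) - Pxy 0 (Pyz 0 (U z))‖ ≤ ‖U z‖ * min 2
      (M * ((1 / 2) * Real.sqrt (‖y - x‖ ^ 2 * ‖z - x‖ ^ 2 - ⟪y - x, z - x⟫ ^ 2))) := by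
    rw [mul_min_of_nonneg _ _ (norm_nonneg _)]
    refine le_min ?_ ?_
    · have := norm_sub_le (Pxz 0 (U z)) (Pxy 0 (Pyz 0 (U z)))
      linarith
    · refine hhol.trans (le_of_eq ?_)
      ring
  have h6 : U x - Pxy 0 (U y) = (U x - Pxz 0 (U z)) + (Pxz 0 (U z) - Pxy 0 (Pyz 0 (U z)))
      + Pxy 0 (Pyz 0 (U z) - U y) := by
    rw [map_sub]; abel
  rw [h6]
  have h7 := norm_add₃_le (a := U x - Pxz 0 (U z)) (b := Pxz 0 (U z) - Pxy 0 (Pyz 0 (U z)))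
    (c := Pxy 0 (Pyz 0 (U z) - U y))
  rw [norm_sub_rev (Pyz 0 (U z)) (U y)] at h4
  linarith
end
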